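/- arXiv:dg-ga/9511001 — 2 statements merged into one kernel-verified Lean document; each statement's English description precedes it below -/
import Mathlib

section
/- For every m ∈ ℕ, there exists an (m,σ(m))-dimensional O-system, and O(m,n) = ∅ for every n > σ(m); consequently there exists a (2m,σ(m)+1)-dimensional Clifford system, and C(2m,n) = ∅ for every n > σ(m)+1. -/
open Matrix BigOperators

/-- Partial derivative in the `i`-th coordinate direction. -/
noncomputable def pderiv {m : ℕ} (i : Fin m) (f : (Fin m → ℝ) → ℝ) : (Fin m → ℝ) → ℝ :=
  fun x => fderiv ℝ f x (Pi.single i 1)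

/-- A map `ℝ^m → ℝ^n` is a harmonic morphism iff each component is harmonic and
the map is horizontally weakly conformal. -/
def IsHarmonicMorphism {m n : ℕ} (φ : (Fin m → ℝ) → (Fin n → ℝ)) : Prop :=
  (∀ (α : Fin n) (x : Fin m → ℝ), ∑ i : Fin m, pderiv i (pderiv i fun y => φ y α) x = 0) ∧
  ∃ lam : (Fin m → ℝ) → ℝ, ∀ (x : Fin m → ℝ) (α β : Fin n),
      ∑ i : Fin m, pderiv i (fun y => φ y α) x * pderiv i (fun y => φ y β) x
        = lam x ^ 2 * (if α = β then 1 else 0)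

/-- `A` is the family of symmetric component matrices of the quadratic map `φ`;
the components are genuine (nonzero) quadratic forms. -/
def Represents {m n : ℕ} (A : Fin n → Matrix (Fin m) (Fin m) ℝ)
    (φ : (Fin m → ℝ) → (Fin n → ℝ)) : Prop :=
  (∀ α, (A α).IsSymm) ∧ (∀ α, A α ≠ 0) ∧ ∀ x α, φ x α = x ⬝ᵥ (A α).mulVec x

/-- A quadratic harmonic morphism. -/
def IsQuadraticHM {m n : ℕ} (φ : (Fin m → ℝ) → (Fin n → ℝ)) : Prop :=
  (∃ A, Represents A φ) ∧ IsHarmonicMorphism φ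

/-- `μ` is an eigenvalue of `A`. -/
def HasEigen {m : ℕ} (A : Matrix (Fin m) (Fin m) ℝ) (μ : ℝ) : Prop :=
  ∃ v : Fin m → ℝ, v ≠ 0 ∧ A.mulVec v = μ • v

/-- `φ` is Q-nonsingular: the common rank of the component matrices equals the
domain dimension. -/
def QNonsingular {m n : ℕ} (φ : (Fin m → ℝ) → (Fin n → ℝ)) : Prop :=
  ∃ A, Represents A φ ∧ ∀ α, (A α).rank = m

/-- `φ` is umbilical: all positive eigenvalues of the component matrices are equal. -/
def Umbilical {m n : ℕ} (φ : (Fin m → ℝ) → (Fin n → ℝ)) : Prop :=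
  ∃ A, Represents A φ ∧ ∀ (α : Fin n) (μ ν : ℝ), 0 < μ → 0 < ν →
    HasEigen (A α) μ → HasEigen (A α) ν → μ = ν

/-- `φ ∈ H₂¹(m,n)`: umbilical quadratic harmonic morphism with positive eigenvalue 1. -/
def MemH21 {m n : ℕ} (φ : (Fin m → ℝ) → (Fin n → ℝ)) : Prop :=
  IsQuadraticHM φ ∧ ∃ A, Represents A φ ∧
    ∀ α : Fin n, HasEigen (A α) 1 ∧ ∀ μ : ℝ, 0 < μ → HasEigen (A α) μ → μ = 1

/-- `G` is an orthogonal matrix. -/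
def IsOrthoMat {m : ℕ} (G : Matrix (Fin m) (Fin m) ℝ) : Prop := Gᵀ * G = 1

/-- Domain-equivalence: `φ = ψ ∘ G` for an orthogonal `G`. -/
def DomainEquiv {m n : ℕ} (φ ψ : (Fin m → ℝ) → (Fin n → ℝ)) : Prop :=
  ∃ G : Matrix (Fin m) (Fin m) ℝ, IsOrthoMat G ∧ ∀ x, φ x = ψ (G.mulVec x)

/-- Bi-equivalence: `φ = H⁻¹ ∘ ψ ∘ G` for orthogonal `G`, `H`. -/
def BiEquiv {m n : ℕ} (φ ψ : (Fin m → ℝ) → (Fin n → ℝ)) : Prop :=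
  ∃ (G : Matrix (Fin m) (Fin m) ℝ) (H : Matrix (Fin n) (Fin n) ℝ),
    IsOrthoMat G ∧ IsOrthoMat H ∧ ∀ x, φ x = H⁻¹.mulVec (ψ (G.mulVec x))

/-- A Clifford system: symmetric endomorphisms with `PᵢPⱼ + PⱼPᵢ = 2δᵢⱼ Id`. -/
def IsCliffordSystem {N n : ℕ} (P : Fin n → Matrix (Fin N) (Fin N) ℝ) : Prop :=
  (∀ i, (P i).IsSymm) ∧
  ∀ i j, P i * P j + P j * P i =
    if i = j then (2 : ℝ) • (1 : Matrix (Fin N) (Fin N) ℝ) else 0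

/-- The map `F` sending a Clifford system to the quadratic map
`X ↦ (⟨P₁X,X⟩,…,⟨PₙX,X⟩)`. -/
def cliffordMap {N n : ℕ} (P : Fin n → Matrix (Fin N) (Fin N) ℝ) :
    (Fin N → ℝ) → Fin n → ℝ := fun X α => X ⬝ᵥ (P α).mulVec X

/-- Algebraic equivalence of Clifford systems. -/
def CliffordAlgEquiv {N n : ℕ} (P Q : Fin n → Matrix (Fin N) (Fin N) ℝ) : Prop :=
  ∃ A : Matrix (Fin N) (Fin N) ℝ, IsOrthoMat A ∧ ∀ i, Q i = A * P i * Aᵀ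

/-- Irreducibility: the space is not a direct sum of two nontrivial invariant subspaces. -/
def CliffordIrreducible {N n : ℕ} (P : Fin n → Matrix (Fin N) (Fin N) ℝ) : Prop :=
  ¬∃ U V : Submodule ℝ (Fin N → ℝ), U ≠ ⊥ ∧ V ≠ ⊥ ∧ IsCompl U V ∧
    (∀ i, ∀ x ∈ U, (P i).mulVec x ∈ U) ∧ ∀ i, ∀ x ∈ V, (P i).mulVec x ∈ V

/-- An O-system: orthogonal endomorphisms with `τᵢᵗτⱼ + τⱼᵗτᵢ = 2δᵢⱼ Id`. -/
def IsOSystem {m n : ℕ} (τ : Fin n → Matrix (Fin m) (Fin m) ℝ) : Prop :=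
  (∀ i, (τ i)ᵀ * τ i = 1) ∧
  ∀ i j, (τ i)ᵀ * τ j + (τ j)ᵀ * τ i =
    if i = j then (2 : ℝ) • (1 : Matrix (Fin m) (Fin m) ℝ) else 0

/-- Algebraic equivalence of O-systems. -/
def OAlgEquiv {m n : ℕ} (τ ρ : Fin n → Matrix (Fin m) (Fin m) ℝ) : Prop :=
  ∃ θ : Matrix (Fin m) (Fin m) ℝ, IsOrthoMat θ ∧ ∀ i, ρ i = θ * τ i * θᵀ

/-- Block-diagonal direct sum of square matrices. -/
def bdiag {m l : ℕ} (A : Matrix (Fin m) (Fin m) ℝ) (B : Matrix (Fin l) (Fin l) ℝ) :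
    Matrix (Fin (m + l)) (Fin (m + l)) ℝ :=
  (Matrix.fromBlocks A 0 0 B).submatrix finSumFinEquiv.symm finSumFinEquiv.symm

/-- The block matrix `[[I,0],[0,-I]]`. -/
def assocP0 (m : ℕ) : Matrix (Fin (m + m)) (Fin (m + m)) ℝ :=
  (Matrix.fromBlocks 1 0 0 (-1)).submatrix finSumFinEquiv.symm finSumFinEquiv.symm

/-- The block matrix `[[0,τ],[τᵗ,0]]`. -/
def assocPi {m : ℕ} (τ : Matrix (Fin m) (Fin m) ℝ) : Matrix (Fin (m + m)) (Fin (m + m)) ℝ :=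
  (Matrix.fromBlocks 0 τ τᵀ 0).submatrix finSumFinEquiv.symm finSumFinEquiv.symm

/-- The Clifford system `(P₀,P₁,…,Pₙ)` associated to an O-system `(τ₁,…,τₙ)`. -/
def assocClifford {m n : ℕ} (τ : Fin n → Matrix (Fin m) (Fin m) ℝ) :
    Fin (n + 1) → Matrix (Fin (m + m)) (Fin (m + m)) ℝ :=
  Fin.cons (assocP0 m) fun j => assocPi (τ j)

/-- Direct sum of two maps: `(φ ⊕ ψ)(x,y) = φ(x) + ψ(y)`. -/
def dsum {m l n : ℕ} (φ : (Fin m → ℝ) → Fin n → ℝ) (ψ : (Fin l → ℝ) → Fin n → ℝ) :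
    (Fin (m + l) → ℝ) → Fin n → ℝ :=
  fun x => φ (fun i => x (Fin.castAdd l i)) + ψ fun j => x (Fin.natAdd m j)

/-- Transport a map along an equality of domain dimensions. -/
def reMap {a b n : ℕ} (h : a = b) (ψ : (Fin b → ℝ) → Fin n → ℝ) :
    (Fin a → ℝ) → Fin n → ℝ := fun x => ψ fun i => x (finCongr h.symm i)

/-- A separable quadratic harmonic morphism. -/
def Separable {M n : ℕ} (φ : (Fin M → ℝ) → Fin n → ℝ) : Prop :=
  ∃ (m l : ℕ) (h : M = m + l), 0 < m ∧ 0 < l ∧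
    ∃ (φ₁ : (Fin m → ℝ) → Fin n → ℝ) (φ₂ : (Fin l → ℝ) → Fin n → ℝ),
      IsQuadraticHM φ₁ ∧ IsQuadraticHM φ₂ ∧ φ = reMap h (dsum φ₁ φ₂)

/-- The `k`-fold direct sum `ψ₁ ⊕ … ⊕ ψₖ` of maps with the same domain dimension. -/
def bigDSum {k M n : ℕ} (ψ : Fin k → (Fin M → ℝ) → Fin n → ℝ) :
    (Fin (k * M) → ℝ) → Fin n → ℝ :=
  fun x => ∑ j : Fin k, ψ j fun i => x (finProdFinEquiv (j, i))

/-- Domain-minimality: no quadratic harmonic morphism into `ℝ^n` exists from a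
smaller-dimensional domain. -/
def DomainMinimal {M n : ℕ} (φ : (Fin M → ℝ) → Fin n → ℝ) : Prop :=
  IsQuadraticHM φ ∧ ∀ M' : ℕ, M' < M → ¬∃ ψ : (Fin M' → ℝ) → Fin n → ℝ, IsQuadraticHM ψ

/-- `m(n)`: dimensions of irreducible Clifford systems;
`m(1)=1, m(2)=2, m(3)=m(4)=4, m(5)=…=m(8)=8, m(n+8)=16m(n)`. -/
def mfun : ℕ → ℕ
  | 0 => 1
  | 1 => 1
  | 2 => 2
  | 3 => 4
  | 4 => 4
  | 5 => 8
  | 6 => 8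
  | 7 => 8
  | 8 => 8
  | n + 9 => 16 * mfun (n + 1)

/-- The Hurwitz–Radon number: for `m = (2r+1)·2^(c+4d)` with `0 ≤ c ≤ 3`,
`σ(m) = 2^c + 8d`. -/
def hrSigma (m : ℕ) : ℕ := 2 ^ (padicValNat 2 m % 4) + 8 * (padicValNat 2 m / 4)

/-- Two ring elements anticommute. -/
def AntiCommute {A : Type*} [Ring A] (x y : A) : Prop := x * y = -(y * x)

theorem AntiCommute.symm {A : Type*} [Ring A] {x y : A} (h : AntiCommute x y) :
    AntiCommute y x := by
  unfold AntiCommute at *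
  rw [h, neg_neg]

/-- Pairwise anticommuting elements, those of `e` squaring to `-1`, those of `f` to `1`. -/
structure IsCliffordLists {A : Type*} [Ring A] (e f : List A) : Prop where
  sq_neg : ∀ x ∈ e, x * x = -1
  sq_pos : ∀ x ∈ f, x * x = 1
  anti : (e ++ f).Pairwise AntiCommute

section Quad

variable {A : Type*} [Ring A] {a b c d : A} {l : List A}

theorem quad_mul_self {ε : A} (hε : ε = 1 ∨ ε = -1)
    (ha : a * a = ε) (hb : b * b = ε) (hc : c * c = ε) (hd : d * d = ε)
    (h : (a :: b :: c :: d :: l).Pairwise AntiCommute) :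
    (a * b * c * d) * (a * b * c * d) = 1 := by
  simp only [List.pairwise_cons, List.mem_cons, forall_eq_or_imp] at h
  obtain ⟨⟨ab, ac, ad, -⟩, ⟨bc, bd, -⟩, ⟨cd, -⟩, -⟩ := h
  have ba := ab.symm
  have ca := ac.symm
  have da := ad.symm
  have cb := bc.symm
  have db := bd.symm
  have dc := cd.symm
  unfold AntiCommute at *
  have sw {x y : A} (h : x * y = -(y * x)) (z : A) : x * (y * z) = -(y * (x * z)) := by
    rw [← mul_assoc, h, neg_mul, mul_assoc]
  have sq {x : A} (h : x * x = ε) (z : A) : x * (x * z) = ε * z := by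
    rw [← mul_assoc, h]
  rcases hε with rfl | rfl <;>
  simp [mul_assoc, sw ba, sw ca, sw da, sw cb, sw db, sw dc, ha, hb, hc, hd]

theorem quad_anti (h : (a :: b :: c :: d :: l).Pairwise AntiCommute) :
    ∀ x ∈ [a, b, c, d], AntiCommute (a * b * c * d) x := by
  simp only [List.pairwise_cons, List.mem_cons, forall_eq_or_imp] at h
  obtain ⟨⟨ab, ac, ad, -⟩, ⟨bc, bd, -⟩, ⟨cd, -⟩, -⟩ := h
  have ba := ab.symm
  have ca := ac.symm
  have da := ad.symm
  have cb := bc.symm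
  have db := bd.symm
  have dc := cd.symm
  clear ab ac ad bc bd cd
  unfold AntiCommute at *
  have sw {x y : A} (h : x * y = -(y * x)) (z : A) : x * (y * z) = -(y * (x * z)) := by
    rw [← mul_assoc, h, neg_mul, mul_assoc]
  simp [mul_assoc, sw ba, sw ca, sw da, sw cb, sw db, sw dc, da, db, dc]

theorem quad_commute (h : (a :: b :: c :: d :: l).Pairwise AntiCommute) :
    ∀ x ∈ l, Commute (a * b * c * d) x := by
  intro x hx
  simp only [List.pairwise_cons, List.mem_cons, forall_eq_or_imp] at h
  obtain ⟨⟨-, -, -, ax⟩, ⟨-, -, bx⟩, ⟨-, cx⟩, dx, -⟩ := h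
  have ax := ax x hx
  have bx := bx x hx
  have cx := cx x hx
  have dx := dx x hx
  unfold AntiCommute at *
  have sw {x y : A} (h : x * y = -(y * x)) (z : A) : x * (y * z) = -(y * (x * z)) := by
    rw [← mul_assoc, h, neg_mul, mul_assoc]
  simp [Commute, SemiconjBy, mul_assoc, sw ax, sw bx, sw cx, dx]

theorem antiCommute_mul_left {w x y : A} (wx : AntiCommute w x)
    (wy : AntiCommute w y) (xy : AntiCommute x y) : AntiCommute (w * x) (w * y) := by
  have wx' := wx.symm
  have wy' := wy.symm
  unfold AntiCommute at *
  calc w * x * (w * y) = w * (x * w) * y := by noncomm_ring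
    _ = - (w * w * (x * y)) := by rw [wx']; noncomm_ring
    _ = w * w * (y * x) := by rw [xy]; noncomm_ring
    _ = -(w * (y * w) * x) := by rw [wy']; noncomm_ring
    _ = -(w * y * (w * x)) := by noncomm_ring

theorem quad_pairwise (h : (a :: b :: c :: d :: l).Pairwise AntiCommute) :
    ([a, b, c, d].map (a * b * c * d * ·) ++ l).Pairwise AntiCommute := by
  have h1 := quad_anti h
  have h2 := quad_commute h
  have h' : ([a, b, c, d] ++ l).Pairwise AntiCommute := h
  generalize a * b * c * d = w at *
  generalize [a, b, c, d] = k at *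
  clear h
  rw [List.pairwise_append] at h' ⊢
  obtain ⟨hk, hl, hkl⟩ := h'
  refine ⟨?_, hl, ?_⟩
  · rw [List.pairwise_map]
    exact hk.imp_of_mem fun hx hy hxy => antiCommute_mul_left (h1 _ hx) (h1 _ hy) hxy
  · intro x hx y hy
    obtain ⟨z, hz, rfl⟩ := List.mem_map.1 hx
    have := h2 y hy
    have hxy := hkl z hz y hy
    unfold AntiCommute at *
    rw [mul_assoc, hxy, mul_neg, ← mul_assoc, this.eq, mul_assoc]

theorem quad_sq {ε : A} (hw : (a * b * c * d) * (a * b * c * d) = 1)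
    (hε : ∀ x ∈ [a, b, c, d], x * x = ε)
    (h : (a :: b :: c :: d :: l).Pairwise AntiCommute) :
    ∀ x ∈ [a, b, c, d].map (a * b * c * d * ·), x * x = -ε := by
  intro y hy
  obtain ⟨x, hx, rfl⟩ := List.mem_map.1 hy
  have h1 := (quad_anti h x hx).symm
  have h2 := hε x hx
  generalize a * b * c * d = w at *
  unfold AntiCommute at h1
  calc w * x * (w * x) = w * (x * w) * x := by noncomm_ring
    _ = -(w * w * (x * x)) := by rw [h1]; noncomm_ring
    _ = -ε := by rw [hw, h2, one_mul]

theorem quad_star [StarRing A] {ε : A} (hε : ε = 1 ∨ ε = -1)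
    (hs : ∀ x ∈ [a, b, c, d], star x = ε * x)
    (h : (a :: b :: c :: d :: l).Pairwise AntiCommute) :
    ∀ x ∈ [a, b, c, d].map (a * b * c * d * ·), star x = -ε * x := by
  have hw : star (a * b * c * d) = a * b * c * d := by
    simp only [List.mem_cons, forall_eq_or_imp, List.not_mem_nil, false_imp_iff,
      implies_true, and_true] at hs
    obtain ⟨sa, sb, sc, sd⟩ := hs
    simp only [List.pairwise_cons, List.mem_cons, forall_eq_or_imp] at h
    obtain ⟨⟨ab, ac, ad, -⟩, ⟨bc, bd, -⟩, ⟨cd, -⟩, -⟩ := h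
    have ba := ab.symm
    have ca := ac.symm
    have da := ad.symm
    have cb := bc.symm
    have db := bd.symm
    have dc := cd.symm
    clear ab ac ad bc bd cd
    unfold AntiCommute at *
    have sw {x y : A} (h : x * y = -(y * x)) (z : A) : x * (y * z) = -(y * (x * z)) := by
      rw [← mul_assoc, h, neg_mul, mul_assoc]
    rcases hε with rfl | rfl <;>
    simp [mul_assoc, sa, sb, sc, sd, sw ba, sw ca, sw cb, da, db, dc]
  intro y hy
  obtain ⟨x, hx, rfl⟩ := List.mem_map.1 hy
  have h1 := (quad_anti h x hx).symm
  have h2 := hs x hx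
  unfold AntiCommute at h1
  rw [star_mul, hw, h2, mul_assoc, h1]
  simp

end Quad

section Swap
variable {A : Type*} [Ring A] {a b c d : A} {e f : List A}

theorem pairwise_antiCommute_perm {k l : List A} (h : k.Perm l) :
    k.Pairwise AntiCommute ↔ l.Pairwise AntiCommute :=
  h.pairwise_iff fun h => h.symm

theorem IsCliffordLists.swap_neg (h : IsCliffordLists (a :: b :: c :: d :: e) f) :
    IsCliffordLists e ([a, b, c, d].map (a * b * c * d * ·) ++ f) := by
  have hp : (a :: b :: c :: d :: (e ++ f)).Pairwise AntiCommute := h.anti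
  have hε : ∀ x ∈ [a, b, c, d], x * x = -1 := fun x hx => h.sq_neg x (by simp_all; tauto)
  have hw := quad_mul_self (Or.inr rfl) (hε a (by simp)) (hε b (by simp)) (hε c (by simp))
    (hε d (by simp)) hp
  have hsq := quad_sq hw hε hp
  have hpw := quad_pairwise hp
  refine ⟨fun x hx => h.sq_neg x (by simp [hx]), fun x hx => ?_, ?_⟩
  · rcases List.mem_append.1 hx with hx | hx
    · rw [hsq x hx, neg_neg]
    · exact h.sq_pos x hx
  · refine (pairwise_antiCommute_perm ?_).1 hpw
    rw [← List.append_assoc, ← List.append_assoc]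
    exact List.perm_append_comm.append_right f

theorem IsCliffordLists.swap_pos (h : IsCliffordLists e (a :: b :: c :: d :: f)) :
    IsCliffordLists ([a, b, c, d].map (a * b * c * d * ·) ++ e) f := by
  have hp : (a :: b :: c :: d :: (e ++ f)).Pairwise AntiCommute := by
    refine (pairwise_antiCommute_perm ?_).1 h.anti
    rw [show a :: b :: c :: d :: f = [a, b, c, d] ++ f from rfl,
      show a :: b :: c :: d :: (e ++ f) = [a, b, c, d] ++ (e ++ f) from rfl,
      ← List.append_assoc, ← List.append_assoc]
    exact List.perm_append_comm.append_right f
  have hε : ∀ x ∈ [a, b, c, d], x * x = 1 := fun x hx => h.sq_pos x (by simp_all; tauto)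
  have hw := quad_mul_self (Or.inl rfl) (hε a (by simp)) (hε b (by simp)) (hε c (by simp))
    (hε d (by simp)) hp
  have hsq := quad_sq hw hε hp
  have hpw := quad_pairwise hp
  refine ⟨fun x hx => ?_, fun x hx => h.sq_pos x (by simp [hx]), ?_⟩
  · rcases List.mem_append.1 hx with hx | hx
    · exact hsq x hx
    · exact h.sq_neg x hx
  · rwa [List.append_assoc]

end Swap

section Compression

variable {n k : ℕ}

theorem exists_factorization_of_idempotent (P : Matrix (Fin n) (Fin n) ℝ) (hP : P * P = P) :
    ∃ (k : ℕ) (L : Matrix (Fin k) (Fin n) ℝ) (R : Matrix (Fin n) (Fin k) ℝ),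
      L * R = 1 ∧ R * L = P := by
  set f := Matrix.toLin' P with hf
  have hff : f ∘ₗ f = f := by rw [hf, ← Matrix.toLin'_mul, hP]
  let φ := (Module.finBasis ℝ (LinearMap.range f)).equivFun
  refine ⟨_, LinearMap.toMatrix' (φ.toLinearMap ∘ₗ f.rangeRestrict),
    LinearMap.toMatrix' ((LinearMap.range f).subtype ∘ₗ φ.symm.toLinearMap), ?_, ?_⟩
  · rw [← LinearMap.toMatrix'_comp, ← LinearMap.toMatrix'_id]
    congr 1
    refine LinearMap.ext fun v => ?_
    obtain ⟨w, rfl⟩ := φ.surjective v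
    obtain ⟨_, u, rfl⟩ := w
    simp only [LinearMap.comp_apply, LinearEquiv.coe_coe, LinearEquiv.symm_apply_apply,
      Submodule.subtype_apply, LinearMap.id_apply]
    congr 1
    exact Subtype.ext (LinearMap.congr_fun hff u)
  · rw [← LinearMap.toMatrix'_comp]
    convert LinearMap.toMatrix'_toLin' P
    refine LinearMap.ext fun v => ?_
    simp [hf]

theorem exists_half_factorization {a b : Matrix (Fin n) (Fin n) ℝ}
    (ha : a * a = 1 ∨ a * a = -1) (hb : b * b = 1) (hab : AntiCommute a b) :
    ∃ (k : ℕ) (L : Matrix (Fin k) (Fin n) ℝ) (R : Matrix (Fin n) (Fin k) ℝ),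
      n = 2 * k ∧ L * R = 1 ∧ R * L = (1 / 2 : ℝ) • (1 + b) := by
  obtain ⟨k, L, R, hLR, hRL⟩ := exists_factorization_of_idempotent ((1 / 2 : ℝ) • (1 + b)) (by
    rw [smul_mul_smul_comm, mul_add, add_mul, add_mul, hb, one_mul, one_mul, mul_one]
    module)
  refine ⟨k, L, R, ?_, hLR, hRL⟩
  have htr : b.trace = 0 := by
    have h : (a * b * a).trace = -(a * a * b).trace := by
      rw [hab, neg_mul, Matrix.trace_neg, Matrix.mul_assoc, Matrix.trace_mul_comm]
    rw [Matrix.trace_mul_comm, ← Matrix.mul_assoc] at h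
    rcases ha with ha | ha <;> simp [ha] at h <;> linarith
  have h := Matrix.trace_mul_comm L R
  rw [hLR, hRL] at h
  simp [htr] at h
  have : (n : ℝ) = 2 * k := by linarith
  exact_mod_cast this

theorem compress_mul {b x y : Matrix (Fin n) (Fin n) ℝ}
    {L : Matrix (Fin k) (Fin n) ℝ} {R : Matrix (Fin n) (Fin k) ℝ}
    (hLR : L * R = 1) (hRL : R * L = (1 / 2 : ℝ) • (1 + b)) (hy : b * y = y * b) :
    L * x * R * (L * y * R) = L * (x * y) * R := by
  have hc : R * L * y = y * (R * L) := by
    rw [hRL, smul_mul_assoc, mul_smul_comm, mul_add, add_mul, hy, one_mul, mul_one]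
  calc L * x * R * (L * y * R) = L * x * (R * L * y) * R := by simp only [Matrix.mul_assoc]
    _ = L * (x * y) * R * (L * R) := by rw [hc]; simp only [Matrix.mul_assoc]
    _ = L * (x * y) * R := by rw [hLR, Matrix.mul_one]

theorem commute_of_antiCommute {A : Type*} [Ring A] {a b x : A}
    (ha : AntiCommute a b) (hx : AntiCommute x b) : b * (a * x) = a * x * b := by
  unfold AntiCommute at *
  rw [mul_assoc, hx, mul_neg, ← mul_assoc, ← mul_assoc, ha, neg_mul, neg_neg]

theorem mul_mul_self_of_antiCommute {A : Type*} [Ring A] {a x : A}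
    (h : AntiCommute a x) : a * x * (a * x) = -(a * a * (x * x)) := by
  have h' := h.symm
  unfold AntiCommute at h'
  calc a * x * (a * x) = a * (x * a) * x := by noncomm_ring
    _ = _ := by rw [h']; noncomm_ring

section

variable {a b : Matrix (Fin n) (Fin n) ℝ} {l : List (Matrix (Fin n) (Fin n) ℝ)}
  {L : Matrix (Fin k) (Fin n) ℝ} {R : Matrix (Fin n) (Fin k) ℝ}

theorem compress_pairwise (hLR : L * R = 1) (hRL : R * L = (1 / 2 : ℝ) • (1 + b))
    (h : (b :: a :: l).Pairwise AntiCommute) :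
    (l.map fun x => L * (a * x) * R).Pairwise AntiCommute := by
  simp only [List.pairwise_cons, List.mem_cons, forall_eq_or_imp] at h
  obtain ⟨⟨hba, hbl⟩, hal, hl⟩ := h
  rw [List.pairwise_map]
  refine hl.imp_of_mem fun {x y} hx hy hxy => ?_
  have h := antiCommute_mul_left (hal x hx) (hal y hy) hxy
  unfold AntiCommute at h ⊢
  rw [compress_mul hLR hRL (commute_of_antiCommute hba.symm (hbl y hy).symm),
    compress_mul hLR hRL (commute_of_antiCommute hba.symm (hbl x hx).symm), h,
    Matrix.mul_neg, Matrix.neg_mul]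

theorem compress_sq (hLR : L * R = 1) (hRL : R * L = (1 / 2 : ℝ) • (1 + b))
    (h : (b :: a :: l).Pairwise AntiCommute) {x : Matrix (Fin n) (Fin n) ℝ} (hx : x ∈ l) :
    L * (a * x) * R * (L * (a * x) * R) = L * -(a * a * (x * x)) * R := by
  simp only [List.pairwise_cons, List.mem_cons, forall_eq_or_imp] at h
  obtain ⟨⟨hba, hbl⟩, hal, hl⟩ := h
  rw [compress_mul hLR hRL (commute_of_antiCommute hba.symm (hbl x hx).symm),
    mul_mul_self_of_antiCommute (hal x hx)]

end

/-- There are `p + q` pairwise anticommuting real `n × n` matrices, of which `p` square to `-1`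
and `q` square to `1`. -/
def HasCliffordLists (p q n : ℕ) : Prop :=
  ∃ e f : List (Matrix (Fin n) (Fin n) ℝ), e.length = p ∧ f.length = q ∧ IsCliffordLists e f

theorem HasCliffordLists.reduce {p q n : ℕ} (h : HasCliffordLists (p + 1) (q + 1) n) :
    ∃ k, n = 2 * k ∧ HasCliffordLists p q k := by
  obtain ⟨_ | ⟨a, e⟩, _ | ⟨b, f⟩, he, hf, h⟩ := h
  · simp at he
  · simp at he
  · simp at hf
  have hp : (b :: a :: (e ++ f)).Pairwise AntiCommute := by
    refine (pairwise_antiCommute_perm ?_).1 h.anti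
    exact List.perm_middle
  have ha := h.sq_neg a (by simp)
  have hb := h.sq_pos b (by simp)
  have hab : AntiCommute a b := ((List.pairwise_cons.1 hp).1 a (by simp)).symm
  obtain ⟨k, L, R, hk, hLR, hRL⟩ := exists_half_factorization (Or.inr ha) hb hab
  refine ⟨k, hk, e.map fun x => L * (a * x) * R, f.map fun x => L * (a * x) * R,
    by simpa using he, by simpa using hf, ?_, ?_, ?_⟩
  · intro y hy
    obtain ⟨x, hx, rfl⟩ := List.mem_map.1 hy
    rw [compress_sq hLR hRL hp (by simp [hx]), ha, h.sq_neg x (by simp [hx])]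
    simp [hLR]
  · intro y hy
    obtain ⟨x, hx, rfl⟩ := List.mem_map.1 hy
    rw [compress_sq hLR hRL hp (by simp [hx]), ha, h.sq_pos x (by simp [hx])]
    simp [hLR]
  · rw [← List.map_append]
    exact compress_pairwise hLR hRL hp

theorem HasCliffordLists.reduce_pos {q n : ℕ} (h : HasCliffordLists 0 (q + 2) n) :
    ∃ k, n = 2 * k ∧ HasCliffordLists q 0 k := by
  obtain ⟨_ | ⟨_, e⟩, _ | ⟨b, _ | ⟨a, f⟩⟩, he, hf, h⟩ := h
  · simp at hf
  · simp at hf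
  · have hp : (b :: a :: f).Pairwise AntiCommute := h.anti
    have ha := h.sq_pos a (by simp)
    have hb := h.sq_pos b (by simp)
    have hab : AntiCommute a b := ((List.pairwise_cons.1 hp).1 a (by simp)).symm
    obtain ⟨k, L, R, hk, hLR, hRL⟩ := exists_half_factorization (Or.inl ha) hb hab
    refine ⟨k, hk, f.map fun x => L * (a * x) * R, [], by simpa using hf, rfl, ?_, by simp, ?_⟩
    · intro y hy
      obtain ⟨x, hx, rfl⟩ := List.mem_map.1 hy
      rw [compress_sq hLR hRL hp (by simp [hx]), ha, h.sq_pos x (by simp [hx])]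
      simp [hLR]
    · rw [List.append_nil]
      exact compress_pairwise hLR hRL hp
  all_goals simp at he

theorem HasCliffordLists.swap_neg {p q n : ℕ} (h : HasCliffordLists (p + 4) q n) :
    HasCliffordLists p (q + 4) n := by
  obtain ⟨_ | ⟨a, _ | ⟨b, _ | ⟨c, _ | ⟨d, e⟩⟩⟩⟩, f, he, hf, h⟩ := h
  case cons.cons.cons.cons =>
    exact ⟨_, _, by simpa using he, by simp [hf], h.swap_neg⟩
  all_goals simp at he

theorem HasCliffordLists.mono {p p' q n : ℕ} (h : HasCliffordLists p q n) (hp : p' ≤ p) :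
    HasCliffordLists p' q n := by
  obtain ⟨e, f, he, hf, h⟩ := h
  refine ⟨e.take p', f, by simp [he, hp], hf, fun x hx => h.sq_neg x (List.mem_of_mem_take hx),
    h.sq_pos, h.anti.sublist ?_⟩
  exact (List.take_sublist _ _).append (List.Sublist.refl _)

theorem HasCliffordLists.periodicity {p n : ℕ} (h : HasCliffordLists (p + 8) 0 n) :
    ∃ k, n = 16 * k ∧ HasCliffordLists p 0 k := by
  obtain ⟨k₁, h₁, h⟩ := HasCliffordLists.reduce (h.swap_neg (p := p + 4))
  obtain ⟨k₂, h₂, h⟩ := h.reduce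
  obtain ⟨k₃, h₃, h⟩ := h.reduce
  obtain ⟨k₄, h₄, h⟩ := h.reduce
  exact ⟨k₄, by omega, h⟩

theorem HasCliffordLists.two_dvd {n : ℕ} (h : HasCliffordLists 1 0 n) : 2 ∣ n := by
  obtain ⟨_ | ⟨a, e⟩, f, he, hf, h⟩ := h
  · simp at he
  have ha := congrArg Matrix.det (h.sq_neg a (by simp))
  rw [Matrix.det_mul, Matrix.det_neg, Matrix.det_one, mul_one, Fintype.card_fin] at ha
  by_contra hn
  rw [← even_iff_two_dvd, Nat.not_even_iff_odd] at hn
  rw [hn.neg_one_pow] at ha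
  nlinarith [mul_self_nonneg a.det]

theorem HasCliffordLists.four_dvd {n : ℕ} (h : HasCliffordLists 2 0 n) : 4 ∣ n := by
  obtain ⟨_ | ⟨a, _ | ⟨b, e⟩⟩, f, he, hf, h⟩ := h
  · simp at he
  · simp at he
  have ha := h.sq_neg a (by simp)
  have hb := h.sq_neg b (by simp)
  have hab : b * a = -(a * b) := ((List.pairwise_cons.1 h.anti).1 b (by simp)).symm
  let q : QuaternionAlgebra.Basis (Matrix (Fin n) (Fin n) ℝ) (-1 : ℝ) 0 (-1) :=
    { i := a
      j := b
      k := a * b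
      i_mul_i := by simp [ha]
      j_mul_j := by simp [hb]
      i_mul_j := rfl
      j_mul_i := by simp [hab] }
  let φ : Quaternion ℝ →ₐ[ℝ] Module.End ℝ (Fin n → ℝ) :=
    (Matrix.toLinAlgEquiv' : Matrix (Fin n) (Fin n) ℝ ≃ₐ[ℝ] _).toAlgHom.comp q.liftHom
  let _ : Module (Quaternion ℝ) (Fin n → ℝ) := Module.compHom _ φ.toRingHom
  have hsmul (z : Quaternion ℝ) (v : Fin n → ℝ) : z • v = φ z v := rfl
  have _ : IsScalarTower ℝ (Quaternion ℝ) (Fin n → ℝ) := ⟨fun r z v => by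
    rw [hsmul, hsmul, map_smul]; rfl⟩
  have := Module.finrank_mul_finrank ℝ (Quaternion ℝ) (Fin n → ℝ)
  rw [Quaternion.finrank_eq_four, Module.finrank_fin_fun] at this
  exact ⟨_, this.symm⟩

theorem HasCliffordLists.eight_dvd {n : ℕ} (h : HasCliffordLists 4 0 n) : 8 ∣ n := by
  obtain ⟨k, rfl, h'⟩ := HasCliffordLists.reduce_pos (h.swap_neg (p := 0))
  exact mul_dvd_mul_left 2 h'.four_dvd

end Compression

theorem hrSigma_mul_sixteen {m : ℕ} (hm : 0 < m) : hrSigma (16 * m) = hrSigma m + 8 := by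
  have h : padicValNat 2 (16 * m) = padicValNat 2 m + 4 := by
    rw [show 16 * m = 2 ^ 4 * m by norm_num, padicValNat.mul (by simp) hm.ne',
      padicValNat.prime_pow, add_comm]
  unfold hrSigma
  rw [h, Nat.add_mod_right, Nat.add_div_right _ (by norm_num)]
  ring

theorem two_pow_le_hrSigma {m c : ℕ} (hc : c ≤ 3) (hm : 0 < m) (h : 2 ^ c ∣ m) :
    2 ^ c ≤ hrSigma m := by
  have hv : c ≤ padicValNat 2 m := (padicValNat_dvd_iff_le hm.ne').1 h
  unfold hrSigma
  generalize padicValNat 2 m = v at *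
  rcases Nat.lt_or_ge v 4 with h4 | h4
  · rw [Nat.mod_eq_of_lt h4]
    exact (Nat.pow_le_pow_right (by norm_num) hv).trans (Nat.le_add_right _ _)
  · have := Nat.pow_le_pow_right (n := 2) (by norm_num) hc
    have := Nat.zero_le (2 ^ (v % 4))
    omega

theorem HasCliffordLists.lt_hrSigma {k n : ℕ} (hn : 0 < n) (h : HasCliffordLists k 0 n) :
    k < hrSigma n := by
  induction k using Nat.strong_induction_on generalizing n with
  | _ k ih =>
    rcases Nat.lt_or_ge k 8 with hk | hk
    · rcases Nat.lt_or_ge k 4 with h4 | h4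
      · rcases Nat.lt_or_ge k 2 with h2 | h2
        · rcases Nat.lt_or_ge k 1 with h1 | h1
          · have := two_pow_le_hrSigma (c := 0) (by norm_num) hn (one_dvd _)
            omega
          · have := two_pow_le_hrSigma (c := 1) (by norm_num) hn (h.mono h1).two_dvd
            omega
        · have := two_pow_le_hrSigma (c := 2) (by norm_num) hn (h.mono h2).four_dvd
          omega
      · have := two_pow_le_hrSigma (c := 3) (by norm_num) hn (h.mono h4).eight_dvd
        omega
    · obtain ⟨p, rfl⟩ := Nat.exists_eq_add_of_le' hk
      obtain ⟨l, rfl, h'⟩ := h.periodicity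
      have hl : 0 < l := by omega
      have := ih p (by omega) hl h'
      rw [hrSigma_mul_sixteen hl]
      omega

section Existence

/-- The Kronecker product of square matrices, with indices flattened to `Fin (r * n)`. -/
def finKronecker {r n : ℕ} (S : Matrix (Fin r) (Fin r) ℝ) (x : Matrix (Fin n) (Fin n) ℝ) :
    Matrix (Fin (r * n)) (Fin (r * n)) ℝ :=
  Matrix.reindexAlgEquiv ℝ ℝ finProdFinEquiv (Matrix.kronecker S x)

section

variable {r n : ℕ} (S T : Matrix (Fin r) (Fin r) ℝ) (x y : Matrix (Fin n) (Fin n) ℝ)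

theorem finKronecker_mul :
    finKronecker S x * finKronecker T y = finKronecker (S * T) (x * y) := by
  unfold finKronecker
  rw [← map_mul]
  exact congrArg _ (Matrix.mul_kronecker_mul S T x y).symm

theorem finKronecker_one :
    finKronecker (1 : Matrix (Fin r) (Fin r) ℝ) (1 : Matrix (Fin n) (Fin n) ℝ) = 1 := by
  unfold finKronecker
  rw [show Matrix.kronecker (1 : Matrix (Fin r) (Fin r) ℝ) (1 : Matrix (Fin n) (Fin n) ℝ) = 1
    from Matrix.one_kronecker_one, map_one]

theorem finKronecker_neg_left : finKronecker (-S) x = -finKronecker S x := by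
  ext i j
  simp [finKronecker]

theorem finKronecker_neg_right : finKronecker S (-x) = -finKronecker S x := by
  ext i j
  simp [finKronecker]

theorem star_finKronecker : star (finKronecker S x) = finKronecker (star S) (star x) := by
  ext i j
  simp [finKronecker, Matrix.star_eq_conjTranspose]

variable {S T x y}

theorem antiCommute_finKronecker_left (h : AntiCommute S T) (h' : Commute x y) :
    AntiCommute (finKronecker S x) (finKronecker T y) := by
  unfold AntiCommute at *
  rw [finKronecker_mul, finKronecker_mul, h, h'.eq, finKronecker_neg_left]

theorem antiCommute_finKronecker_right (h : AntiCommute x y) :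
    AntiCommute (finKronecker S x) (finKronecker S y) := by
  unfold AntiCommute at *
  rw [finKronecker_mul, finKronecker_mul, h, finKronecker_neg_right]

end

/-- There are `p + q` pairwise anticommuting real `n × n` matrices, of which `p` are
skew-symmetric and square to `-1`, and `q` are symmetric and square to `1`. -/
def HasStarCliffordLists (p q n : ℕ) : Prop :=
  ∃ e f : List (Matrix (Fin n) (Fin n) ℝ), e.length = p ∧ f.length = q ∧ IsCliffordLists e f ∧
    (∀ x ∈ e, star x = -x) ∧ ∀ x ∈ f, star x = x

theorem hasStarCliffordLists_zero_one : HasStarCliffordLists 0 1 1 :=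
  ⟨[], [1], rfl, rfl, ⟨by simp, by simp, by simp⟩, by simp, by simp⟩

namespace HasStarCliffordLists

variable {p q n : ℕ}

theorem mono {p' q' : ℕ} (h : HasStarCliffordLists p q n) (hp : p' ≤ p) (hq : q' ≤ q) :
    HasStarCliffordLists p' q' n := by
  obtain ⟨e, f, he, hf, h, hse, hsf⟩ := h
  exact ⟨e.take p', f.take q', by simp [he, hp], by simp [hf, hq],
    ⟨fun x hx => h.sq_neg x (List.mem_of_mem_take hx),
      fun x hx => h.sq_pos x (List.mem_of_mem_take hx),
      h.anti.sublist ((List.take_sublist _ _).append (List.take_sublist _ _))⟩,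
    fun x hx => hse x (List.mem_of_mem_take hx), fun x hx => hsf x (List.mem_of_mem_take hx)⟩

theorem copies (h : HasStarCliffordLists p q n) (r : ℕ) : HasStarCliffordLists p q (r * n) := by
  obtain ⟨e, f, he, hf, h, hse, hsf⟩ := h
  refine ⟨e.map (finKronecker 1), f.map (finKronecker 1), by simpa, by simpa, ⟨?_, ?_, ?_⟩, ?_, ?_⟩
  · simp only [List.forall_mem_map]
    intro x hx
    rw [finKronecker_mul, h.sq_neg x hx, finKronecker_neg_right, one_mul, finKronecker_one]
  · simp only [List.forall_mem_map]
    intro x hx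
    rw [finKronecker_mul, h.sq_pos x hx, one_mul, finKronecker_one]
  · rw [← List.map_append, List.pairwise_map]
    exact h.anti.imp antiCommute_finKronecker_right
  · simp only [List.forall_mem_map]
    intro x hx
    rw [star_finKronecker, hse x hx, finKronecker_neg_right, star_one]
  · simp only [List.forall_mem_map]
    intro x hx
    rw [star_finKronecker, hsf x hx, star_one]

theorem double (h : HasStarCliffordLists p q n) :
    HasStarCliffordLists (p + 1) (q + 1) (2 * n) := by
  obtain ⟨e, f, he, hf, h, hse, hsf⟩ := h
  obtain ⟨J, K, F, hJ, hK, hF, hJK, hJF, hKF, sJ, sK, sF⟩ :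
      ∃ J K F : Matrix (Fin 2) (Fin 2) ℝ, J * J = -1 ∧ K * K = 1 ∧ F * F = 1 ∧
        AntiCommute J K ∧ AntiCommute J F ∧ AntiCommute F K ∧
        star J = -J ∧ star K = K ∧ star F = F := by
    refine ⟨!![0, -1; 1, 0], !![0, 1; 1, 0], !![1, 0; 0, -1], ?_, ?_, ?_, ?_, ?_, ?_, ?_, ?_, ?_⟩ <;>
    (try unfold AntiCommute) <;> ext i j <;> fin_cases i <;> fin_cases j <;>
    simp [Matrix.mul_apply]
  refine ⟨finKronecker J 1 :: e.map (finKronecker K), finKronecker F 1 :: f.map (finKronecker K),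
    by simpa, by simpa, ⟨?_, ?_, ?_⟩, ?_, ?_⟩
  · simp only [List.forall_mem_cons, List.forall_mem_map]
    refine ⟨?_, fun x hx => ?_⟩
    · rw [finKronecker_mul, hJ, finKronecker_neg_left, one_mul, finKronecker_one]
    · rw [finKronecker_mul, h.sq_neg x hx, finKronecker_neg_right, hK, finKronecker_one]
  · simp only [List.forall_mem_cons, List.forall_mem_map]
    refine ⟨?_, fun x hx => ?_⟩
    · rw [finKronecker_mul, hF, one_mul, finKronecker_one]
    · rw [finKronecker_mul, h.sq_pos x hx, hK, finKronecker_one]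
  · have hp : (finKronecker J 1 :: finKronecker F 1 ::
        (e ++ f).map (finKronecker K)).Pairwise AntiCommute := by
      simp only [List.pairwise_cons, List.forall_mem_cons, List.forall_mem_map, List.pairwise_map]
      exact ⟨⟨antiCommute_finKronecker_left hJF (Commute.refl _), fun x _ =>
        antiCommute_finKronecker_left hJK (Commute.one_left x)⟩, fun x _ =>
        antiCommute_finKronecker_left hKF (Commute.one_left x),
        h.anti.imp antiCommute_finKronecker_right⟩
    refine (pairwise_antiCommute_perm ?_).1 hp
    rw [List.map_append, List.cons_append]
    exact List.perm_middle.symm.cons _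
  · simp only [List.forall_mem_cons, List.forall_mem_map]
    refine ⟨?_, fun x hx => ?_⟩
    · rw [star_finKronecker, sJ, star_one, finKronecker_neg_left]
    · rw [star_finKronecker, sK, hse x hx, finKronecker_neg_right]
  · simp only [List.forall_mem_cons, List.forall_mem_map]
    refine ⟨?_, fun x hx => ?_⟩
    · rw [star_finKronecker, sF, star_one]
    · rw [star_finKronecker, sK, hsf x hx]

theorem swap_pos (h : HasStarCliffordLists p (q + 4) n) : HasStarCliffordLists (p + 4) q n := by
  obtain ⟨e, _ | ⟨a, _ | ⟨b, _ | ⟨c, _ | ⟨d, f⟩⟩⟩⟩, he, hf, h, hse, hsf⟩ := h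
  case cons.cons.cons.cons =>
    have hp : (a :: b :: c :: d :: f).Pairwise AntiCommute := (List.pairwise_append.1 h.anti).2.1
    have hs := quad_star (Or.inl rfl)
      (fun x hx => by rw [hsf x (by simp_all; tauto), one_mul]) hp
    refine ⟨_, _, ?_, ?_, h.swap_pos, ?_, fun x hx => hsf x (by simp [hx])⟩
    · simp [he]
    · simpa using hf
    · intro x hx
      rcases List.mem_append.1 hx with hx | hx
      · rw [hs x hx, neg_one_mul]
      · exact hse x hx
  all_goals simp at hf

theorem triple_product (h : HasStarCliffordLists p 3 n) : HasStarCliffordLists (p + 1) 0 n := by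
  obtain ⟨e, _ | ⟨a, _ | ⟨b, _ | ⟨c, _ | ⟨d, f⟩⟩⟩⟩, he, hf, h, hse, hsf⟩ := h
  case cons.cons.cons.nil =>
    obtain ⟨hanti, hf, hef⟩ := List.pairwise_append.1 h.anti
    have ha := h.sq_pos a (by simp)
    have hb := h.sq_pos b (by simp)
    have hc := h.sq_pos c (by simp)
    have sa := hsf a (by simp)
    have sb := hsf b (by simp)
    have sc := hsf c (by simp)
    simp only [List.pairwise_cons, List.mem_cons, forall_eq_or_imp] at hf
    obtain ⟨⟨ab, ac, -⟩, ⟨bc, -⟩, -⟩ := hf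
    have ba := ab.symm
    have ca := ac.symm
    have cb := bc.symm
    clear ab ac bc
    unfold AntiCommute at ba ca cb
    have sw {x y : Matrix (Fin n) (Fin n) ℝ} (h : x * y = -(y * x)) (z) :
        x * (y * z) = -(y * (x * z)) := by
      rw [← mul_assoc, h, neg_mul, mul_assoc]
    have sq {x : Matrix (Fin n) (Fin n) ℝ} (h : x * x = 1) (z) : x * (x * z) = z := by
      rw [← mul_assoc, h, one_mul]
    refine ⟨(a * b * c) :: e, [], by simpa using he, rfl, ⟨?_, by simp, ?_⟩, ?_, by simp⟩
    · simp only [List.forall_mem_cons]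
      refine ⟨?_, h.sq_neg⟩
      simp [mul_assoc, sw ba, sw ca, sw cb, ha, hb, hc]
    · rw [List.append_nil, List.pairwise_cons]
      refine ⟨fun x hx => ?_, hanti⟩
      have xa := hef x hx a (by simp)
      have xb := hef x hx b (by simp)
      have xc := hef x hx c (by simp)
      unfold AntiCommute at xa xb xc ⊢
      simp [mul_assoc, sw xa, sw xb, xc]
    · simp only [List.forall_mem_cons]
      refine ⟨?_, hse⟩
      simp [sa, sb, sc, mul_assoc, sw ba, ca, cb]
  all_goals simp at hf

theorem periodicity (h : HasStarCliffordLists p 0 n) : HasStarCliffordLists (p + 8) 0 (16 * n) := by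
  convert h.double.double.double.double.swap_pos using 1
  ring

end HasStarCliffordLists

theorem hasStarCliffordLists_two_pow (c d : ℕ) (hc : c < 4) :
    HasStarCliffordLists (2 ^ c + 8 * d - 1) 0 (2 ^ (4 * d + c)) := by
  induction d with
  | zero =>
    have h := hasStarCliffordLists_zero_one
    interval_cases c
    · exact h.mono le_rfl zero_le_one
    · exact h.double.mono le_rfl (by norm_num)
    · exact h.double.double.triple_product
    · exact h.double.double.double.swap_pos
  | succ d ih =>
    have := Nat.one_le_two_pow (n := c)
    convert ih.periodicity using 1
    · omega
    · ring

theorem hasStarCliffordLists_hrSigma (m : ℕ) :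
    HasStarCliffordLists (hrSigma m - 1) 0 m := by
  obtain ⟨r, hr⟩ := pow_padicValNat_dvd (p := 2) (n := m)
  have h := (hasStarCliffordLists_two_pow (padicValNat 2 m % 4) (padicValNat 2 m / 4)
    (Nat.mod_lt _ (by norm_num))).copies r
  rwa [Nat.div_add_mod, mul_comm r, ← hr] at h

end Existence

theorem HasStarCliffordLists.exists_isOSystem {k m : ℕ} (h : HasStarCliffordLists k 0 m) :
    ∃ τ : Fin (k + 1) → Matrix (Fin m) (Fin m) ℝ, IsOSystem τ := by
  obtain ⟨e, f, rfl, -, h, hs, -⟩ := h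
  have hp : e.Pairwise AntiCommute := (List.pairwise_append.1 h.anti).1
  have hs' (i) : (e.get i)ᵀ = -e.get i := by
    have := hs _ (e.get_mem i)
    rwa [Matrix.star_eq_conjTranspose, Matrix.conjTranspose_eq_transpose_of_trivial] at this
  have hq (i) : e.get i * e.get i = -1 := h.sq_neg _ (e.get_mem i)
  have hanti {i j} (hij : i ≠ j) : AntiCommute (e.get i) (e.get j) := by
    rcases lt_or_gt_of_ne hij with hij | hij
    · exact List.pairwise_iff_get.1 hp i j hij
    · exact (List.pairwise_iff_get.1 hp j i hij).symm
  refine ⟨Fin.cons 1 e.get, fun i => ?_, fun i j => ?_⟩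
  · refine Fin.cases (by simp) (fun i => ?_) i
    rw [Fin.cons_succ, hs', neg_mul, hq, neg_neg]
  · refine Fin.cases ?_ (fun i => ?_) i <;> refine Fin.cases ?_ (fun j => ?_) j
    · simp [two_smul]
    · rw [Fin.cons_succ, Fin.cons_zero, hs', if_neg (Fin.succ_ne_zero j).symm]
      simp
    · rw [Fin.cons_succ, Fin.cons_zero, hs', if_neg (Fin.succ_ne_zero i)]
      simp
    · rw [Fin.cons_succ, Fin.cons_succ, hs', hs']
      by_cases hij : i = j
      · subst hij
        rw [if_pos rfl, neg_mul, hq, neg_neg, two_smul]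
      · rw [if_neg (by simpa using hij), neg_mul, neg_mul, hanti hij, neg_neg, add_neg_cancel]

theorem IsOSystem.mul_transpose {m n : ℕ} {τ : Fin n → Matrix (Fin m) (Fin m) ℝ}
    (h : IsOSystem τ) (i : Fin n) : τ i * (τ i)ᵀ = 1 :=
  mul_eq_one_comm.1 (h.1 i)

theorem IsOSystem.mul_transpose_add {m n : ℕ} {τ : Fin n → Matrix (Fin m) (Fin m) ℝ}
    (h : IsOSystem τ) (i j : Fin n) : τ i * (τ j)ᵀ + τ j * (τ i)ᵀ =
      if i = j then (2 : ℝ) • (1 : Matrix (Fin m) (Fin m) ℝ) else 0 := by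
  by_cases hij : i = j
  · subst hij
    rw [if_pos rfl, h.mul_transpose, two_smul]
  · have hh := h.2 i j
    rw [if_neg hij] at hh ⊢
    calc τ i * (τ j)ᵀ + τ j * (τ i)ᵀ
        = τ j * (τ j)ᵀ * τ i * (τ j)ᵀ + τ j * (τ i)ᵀ * (τ j * (τ j)ᵀ) := by
          rw [h.mul_transpose, one_mul, mul_one]
      _ = τ j * ((τ i)ᵀ * τ j + (τ j)ᵀ * τ i) * (τ j)ᵀ := by noncomm_ring
      _ = 0 := by rw [hh]; simp

theorem IsOSystem.hasCliffordLists {m k : ℕ} {τ : Fin (k + 1) → Matrix (Fin m) (Fin m) ℝ}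
    (h : IsOSystem τ) : HasCliffordLists k 0 m := by
  have h0 (i : Fin k) : (τ 0)ᵀ * τ i.succ = -((τ i.succ)ᵀ * τ 0) := by
    have := h.2 0 i.succ
    rw [if_neg (Fin.succ_ne_zero i).symm] at this
    exact eq_neg_of_add_eq_zero_left this
  have hmul (i j : Fin k) : (τ 0)ᵀ * τ i.succ * ((τ 0)ᵀ * τ j.succ) =
      -((τ i.succ)ᵀ * τ j.succ) := by
    calc (τ 0)ᵀ * τ i.succ * ((τ 0)ᵀ * τ j.succ)
        = -((τ i.succ)ᵀ * (τ 0 * (τ 0)ᵀ) * τ j.succ) := by rw [h0 i]; noncomm_ring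
      _ = _ := by rw [h.mul_transpose, mul_one]
  refine ⟨List.ofFn fun i : Fin k => (τ 0)ᵀ * τ i.succ, [], by simp, rfl, ?_, by simp, ?_⟩
  · simp only [List.forall_mem_ofFn_iff]
    intro i
    rw [hmul, h.1]
  · rw [List.append_nil, List.pairwise_ofFn]
    intro i j hij
    have := h.2 i.succ j.succ
    rw [if_neg (by simpa using hij.ne)] at this
    unfold AntiCommute
    rw [hmul, hmul, eq_neg_of_add_eq_zero_left this]

theorem submatrix_mul_add_mul {ι κ : Type*} [Fintype ι] [Fintype κ] (A B : Matrix ι ι ℝ)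
    (σ : κ ≃ ι) : A.submatrix σ σ * B.submatrix σ σ + B.submatrix σ σ * A.submatrix σ σ =
      (A * B + B * A).submatrix σ σ := by
  rw [Matrix.submatrix_mul_equiv, Matrix.submatrix_mul_equiv]
  rfl

theorem fromBlocks_two_smul_one_submatrix (m : ℕ) :
    (Matrix.fromBlocks ((2 : ℝ) • (1 : Matrix (Fin m) (Fin m) ℝ)) 0 0 ((2 : ℝ) • 1)).submatrix
      finSumFinEquiv.symm finSumFinEquiv.symm =
    (2 : ℝ) • (1 : Matrix (Fin (m + m)) (Fin (m + m)) ℝ) := by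
  have h : Matrix.fromBlocks ((2 : ℝ) • (1 : Matrix (Fin m) (Fin m) ℝ)) 0 0 ((2 : ℝ) • 1) =
      (2 : ℝ) • (1 : Matrix (Fin m ⊕ Fin m) (Fin m ⊕ Fin m) ℝ) := by
    rw [← Matrix.fromBlocks_one, Matrix.fromBlocks_smul, smul_zero]
  rw [h]
  change (2 : ℝ) • (1 : Matrix (Fin m ⊕ Fin m) (Fin m ⊕ Fin m) ℝ).submatrix
    finSumFinEquiv.symm finSumFinEquiv.symm = _
  rw [Matrix.submatrix_one_equiv]

theorem IsOSystem.isCliffordSystem_assocClifford {m n : ℕ}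
    {τ : Fin n → Matrix (Fin m) (Fin m) ℝ} (h : IsOSystem τ) :
    IsCliffordSystem (assocClifford τ) := by
  refine ⟨fun i => ?_, fun i j => ?_⟩
  · refine Fin.cases ?_ (fun i => ?_) i
    · simp [assocClifford, assocP0, Matrix.IsSymm, Matrix.fromBlocks_transpose]
    · simp [assocClifford, assocPi, Matrix.IsSymm, Matrix.fromBlocks_transpose]
  · refine Fin.cases ?_ (fun i => ?_) i <;> refine Fin.cases ?_ (fun j => ?_) j <;>
    simp only [assocClifford, assocP0, assocPi, Fin.cons_zero, Fin.cons_succ,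
      submatrix_mul_add_mul, Matrix.fromBlocks_multiply, Matrix.fromBlocks_add]
    · rw [if_pos trivial, ← fromBlocks_two_smul_one_submatrix, two_smul]
      simp
    · simp [(Fin.succ_ne_zero j).symm]
    · simp
    · simp only [zero_mul, mul_zero, add_zero, zero_add, h.2, h.mul_transpose_add, Fin.succ_inj]
      split_ifs
      · exact fromBlocks_two_smul_one_submatrix m
      · simp

theorem IsCliffordSystem.hasCliffordLists {N n : ℕ} {P : Fin n → Matrix (Fin N) (Fin N) ℝ}
    (h : IsCliffordSystem P) : HasCliffordLists 0 n N := by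
  refine ⟨[], List.ofFn P, rfl, by simp, by simp, ?_, ?_⟩
  · simp only [List.forall_mem_ofFn_iff]
    intro i
    have := h.2 i i
    rw [if_pos rfl, ← two_smul ℝ] at this
    exact smul_right_injective _ (two_ne_zero (α := ℝ)) this
  · rw [List.nil_append, List.pairwise_ofFn]
    intro i j hij
    have := h.2 i j
    rw [if_neg hij.ne] at this
    exact eq_neg_of_add_eq_zero_left this

/-- For every `m ≥ 1` there is an `(m,σ(m))`-dimensional O-system and
`O(m,n) = ∅` for `n > σ(m)`; consequently there is a `(2m,σ(m)+1)`-dimensional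
Clifford system and `C(2m,n) = ∅` for `n > σ(m)+1`. -/
theorem exists_range_maximal_oSystem_and_clifford (m : ℕ) (hm : 0 < m) :
    (∃ τ : Fin (hrSigma m) → Matrix (Fin m) (Fin m) ℝ, IsOSystem τ) ∧
    (∀ n : ℕ, hrSigma m < n →
        ¬∃ τ : Fin n → Matrix (Fin m) (Fin m) ℝ, IsOSystem τ) ∧
    (∃ P : Fin (hrSigma m + 1) → Matrix (Fin (m + m)) (Fin (m + m)) ℝ,
        IsCliffordSystem P) ∧
    (∀ n : ℕ, hrSigma m + 1 < n →
        ¬∃ P : Fin n → Matrix (Fin (m + m)) (Fin (m + m)) ℝ, IsCliffordSystem P) := by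
  have hO : ∃ τ : Fin (hrSigma m) → Matrix (Fin m) (Fin m) ℝ, IsOSystem τ := by
    have h := (hasStarCliffordLists_hrSigma m).exists_isOSystem
    have h1 : 1 ≤ hrSigma m := two_pow_le_hrSigma (c := 0) (by norm_num) hm (one_dvd m)
    rwa [Nat.sub_add_cancel h1] at h
  refine ⟨hO, ?_, ?_, ?_⟩
  · rintro (_ | n) hn ⟨τ, hτ⟩
    · omega
    · have := hτ.hasCliffordLists.lt_hrSigma hm
      omega
  · obtain ⟨τ, hτ⟩ := hO
    exact ⟨_, hτ.isCliffordSystem_assocClifford⟩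
  · rintro (_ | _ | n) hn ⟨P, hP⟩
    · omega
    · omega
    · obtain ⟨k, hk, h⟩ := hP.hasCliffordLists.reduce_pos
      obtain rfl : k = m := by omega
      have := h.lt_hrSigma hm
      omega
end

section
/- Q-nonsingular umbilical quadratic harmonic morphisms into ℝ^{n+1} exist exactly from domains of dimension 2km(n) with k ∈ ℕ; and every Q-nonsingular umbilical quadratic harmonic morphism φ: ℝ^{2km(n)} → ℝ^{n+1} is, for k = 1, domain-equivalent to λφ₀ for some λ > 0 and some domain-minimal φ₀ ∈ H₂¹(2m(n),n+1), while for k ≥ 2 it is domain-equivalent to λ(φ₁⊕…⊕φₖ) for some λ > 0 and domain-minimal φ₁,…,φₖ ∈ H₂¹(2m(n),n+1). -/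
open Matrix BigOperators

/-- Endomorphisms `a i` with square `1` and `b j` with square `-1`, any two of which anticommute. -/
structure CliffordRep {V : Type} [AddCommGroup V] [Module ℝ V] {p q : ℕ}
    (a : Fin p → Module.End ℝ V) (b : Fin q → Module.End ℝ V) : Prop where
  sq_pos : ∀ i, a i * a i = 1
  sq_neg : ∀ i, b i * b i = -1
  anti_pos : ∀ i j, i ≠ j → a i * a j = -(a j * a i)
  anti_neg : ∀ i j, i ≠ j → b i * b j = -(b j * b i)
  anti_mix : ∀ i j, a i * b j = -(b j * a i)

/-- Every nonzero representation with `p` positive and `q` negative generators has an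
invariant subspace of dimension `d`. -/
def HasSubrep (p q d : ℕ) : Prop :=
  ∀ (V : Type) [AddCommGroup V] [Module ℝ V] [FiniteDimensional ℝ V] [Nontrivial V]
    (a : Fin p → Module.End ℝ V) (b : Fin q → Module.End ℝ V), CliffordRep a b →
    ∃ W : Submodule ℝ V, Module.finrank ℝ W = d ∧
      (∀ i, ∀ x ∈ W, a i x ∈ W) ∧ ∀ i, ∀ x ∈ W, b i x ∈ W

section Subrep

variable {V : Type} [AddCommGroup V] [Module ℝ V]

theorem HasSubrep.exists_le {p q d : ℕ} (h : HasSubrep p q d) [FiniteDimensional ℝ V]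
    (a : Fin p → Module.End ℝ V) (b : Fin q → Module.End ℝ V) (E : Submodule ℝ V) (hE : E ≠ ⊥)
    (ha : ∀ i, ∀ x ∈ E, a i x ∈ E) (hb : ∀ i, ∀ x ∈ E, b i x ∈ E)
    (ha2 : ∀ i, ∀ x ∈ E, a i (a i x) = x) (hb2 : ∀ i, ∀ x ∈ E, b i (b i x) = -x)
    (haa : ∀ i j, i ≠ j → ∀ x ∈ E, a i (a j x) = -a j (a i x))
    (hbb : ∀ i j, i ≠ j → ∀ x ∈ E, b i (b j x) = -b j (b i x))
    (hab : ∀ i j, ∀ x ∈ E, a i (b j x) = -b j (a i x)) :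
    ∃ W ≤ E, Module.finrank ℝ W = d ∧
      (∀ i, ∀ x ∈ W, a i x ∈ W) ∧ ∀ i, ∀ x ∈ W, b i x ∈ W := by
  have : Nontrivial E := Submodule.nontrivial_iff_ne_bot.mpr hE
  obtain ⟨W, hd, hWa, hWb⟩ := h E (fun i => (a i).restrict (ha i)) (fun i => (b i).restrict (hb i))
    { sq_pos := fun i => LinearMap.ext fun x => Subtype.ext (ha2 i x x.2)
      sq_neg := fun i => LinearMap.ext fun x => Subtype.ext (hb2 i x x.2)
      anti_pos := fun i j hij => LinearMap.ext fun x => Subtype.ext (haa i j hij x x.2)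
      anti_neg := fun i j hij => LinearMap.ext fun x => Subtype.ext (hbb i j hij x x.2)
      anti_mix := fun i j => LinearMap.ext fun x => Subtype.ext (hab i j x x.2) }
  refine ⟨W.map E.subtype, Submodule.map_subtype_le _ _, ?_, ?_, ?_⟩
  · rw [Submodule.finrank_map_subtype_eq, hd]
  · rintro i _ ⟨x, hx, rfl⟩
    exact ⟨_, hWa i x hx, rfl⟩
  · rintro i _ ⟨x, hx, rfl⟩
    exact ⟨_, hWb i x hx, rfl⟩

/-- The `1`-eigenspace of an involution anticommuting with an involution is nonzero. -/
theorem eqLocus_involution_ne_bot [Nontrivial V] (w t : Module.End ℝ V) (hw : w * w = 1)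
    (ht : t * t = 1) (hwt : w * t = -(t * w)) : LinearMap.eqLocus w 1 ≠ ⊥ := by
  have : IsAddTorsionFree V := IsAddTorsionFree.of_isTorsionFree ℝ V
  intro h
  have hneg : ∀ x, w x = -x := fun x => by
    have : x + w x ∈ LinearMap.eqLocus w 1 := by
      have := LinearMap.congr_fun hw x
      simp only [Module.End.mul_apply, Module.End.one_apply] at this
      simp [LinearMap.mem_eqLocus, this, add_comm]
    rw [h, Submodule.mem_bot] at this
    exact eq_neg_of_add_eq_zero_right this
  obtain ⟨x, hx⟩ := exists_ne (0 : V)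
  have h1 := LinearMap.congr_fun hwt x
  simp only [Module.End.mul_apply, LinearMap.neg_apply, hneg, map_neg, neg_neg] at h1
  have h2 : t x = 0 := self_eq_neg.mp h1.symm
  have h3 := LinearMap.congr_fun ht x
  simp only [Module.End.mul_apply, Module.End.one_apply, h2, map_zero] at h3
  exact hx h3.symm

theorem mapsTo_eqLocus_of_commute {w g : Module.End ℝ V} (h : Commute w g) :
    ∀ x ∈ LinearMap.eqLocus w 1, g x ∈ LinearMap.eqLocus w 1 := by
  intro x hx
  have h1 : w x = x := hx
  have h2 := LinearMap.congr_fun h.eq x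
  rw [Module.End.mul_apply, Module.End.mul_apply g, h1] at h2
  exact h2

theorem mapsTo_sup_map {W : Submodule ℝ V} {t g : Module.End ℝ V}
    (h1 : ∀ x ∈ W, g x ∈ W ⊔ W.map t) (h2 : ∀ x ∈ W, g (t x) ∈ W ⊔ W.map t) :
    ∀ x ∈ W ⊔ W.map t, g x ∈ W ⊔ W.map t := by
  refine fun x hx => (sup_le (c := (W ⊔ W.map t).comap g) h1 ?_) hx
  rintro _ ⟨x, hx, rfl⟩
  exact h2 x hx

theorem apply_eq_neg_of_anticomm {g h : Module.End ℝ V} (hgh : g * h = -(h * g)) (x : V) :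
    g (h x) = -h (g x) :=
  LinearMap.congr_fun hgh x

/-- If `W` lies in the `1`-eigenspace of `w` and the involution `t` anticommutes with `w`, then
`W + tW` has twice the dimension of `W`. -/
theorem finrank_sup_map_involution [FiniteDimensional ℝ V] (w t : Module.End ℝ V)
    (ht : t * t = 1) (hwt : w * t = -(t * w)) (W : Submodule ℝ V)
    (hW : W ≤ LinearMap.eqLocus w 1) :
    Module.finrank ℝ ↥(W ⊔ W.map t) = 2 * Module.finrank ℝ W := by
  have : IsAddTorsionFree V := IsAddTorsionFree.of_isTorsionFree ℝ V
  have hinj : Function.Injective t := fun x y hxy => by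
    have := congrArg t hxy
    rwa [← Module.End.mul_apply, ← Module.End.mul_apply, ht] at this
  have hinf : W ⊓ W.map t = ⊥ := by
    rw [eq_bot_iff]
    rintro x ⟨hx, y, hy, rfl⟩
    have h1 : w (t y) = t y := hW hx
    have h2 : w y = y := hW hy
    have h3 := apply_eq_neg_of_anticomm hwt y
    rw [h1, h2] at h3
    exact self_eq_neg.mp h3
  have := Submodule.finrank_sup_add_finrank_inf_eq W (W.map t)
  rw [hinf, finrank_bot, add_zero] at this
  rw [this, LinearEquiv.finrank_eq (Submodule.equivMapOfInjective t hinj W).symm]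
  ring

theorem commute_mul_of_anticomm {R : Type*} [Ring R] {e f g : R} (he : e * g = -(g * e))
    (hf : f * g = -(g * f)) : Commute (e * f) g := by
  rw [commute_iff_eq, mul_assoc, hf, mul_neg, ← mul_assoc, he, neg_mul, neg_neg, mul_assoc]

theorem HasSubrep.succ_succ {p q d : ℕ} (h : HasSubrep p q d) :
    HasSubrep (p + 1) (q + 1) (2 * d) := by
  intro V _ _ _ _ a b hab
  have e2 := hab.sq_pos 0
  have f2 := hab.sq_neg 0
  have ef := hab.anti_mix 0 0
  have ea : ∀ i : Fin p, a i.succ * a 0 = -(a 0 * a i.succ) :=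
    fun i => hab.anti_pos _ _ (Fin.succ_ne_zero i)
  have eb : ∀ i : Fin q, a 0 * b i.succ = -(b i.succ * a 0) := fun i => hab.anti_mix _ _
  have eb' : ∀ i : Fin q, b i.succ * a 0 = -(a 0 * b i.succ) := fun i => by rw [eb, neg_neg]
  have ef' : b 0 * a 0 = -(a 0 * b 0) := by rw [ef, neg_neg]
  have w2 : (a 0 * b 0) * (a 0 * b 0) = 1 := by
    rw [mul_assoc, ← mul_assoc (b 0), ef', neg_mul, mul_assoc (a 0), f2, mul_neg_one, neg_neg, e2]
  have wt : (a 0 * b 0) * a 0 = -(a 0 * (a 0 * b 0)) := by rw [mul_assoc, ef', mul_neg]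
  obtain ⟨W, hWE, hd, hWa, hWb⟩ := h.exists_le (fun i => a i.succ) (fun i => b i.succ) _
    (eqLocus_involution_ne_bot _ _ w2 e2 wt)
    (fun i => mapsTo_eqLocus_of_commute (commute_mul_of_anticomm
      (hab.anti_pos _ _ (Fin.succ_ne_zero i).symm) (by rw [hab.anti_mix, neg_neg])))
    (fun i => mapsTo_eqLocus_of_commute (commute_mul_of_anticomm
      (eb i) (hab.anti_neg _ _ (Fin.succ_ne_zero i).symm)))
    (fun i x _ => LinearMap.congr_fun (hab.sq_pos i.succ) x)
    (fun i x _ => LinearMap.congr_fun (hab.sq_neg i.succ) x)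
    (fun i j hij x _ => LinearMap.congr_fun
      (hab.anti_pos _ _ ((Fin.succ_injective _).ne hij)) x)
    (fun i j hij x _ => LinearMap.congr_fun
      (hab.anti_neg _ _ ((Fin.succ_injective _).ne hij)) x)
    (fun i j x _ => LinearMap.congr_fun (hab.anti_mix _ _) x)
  have inl : ∀ x ∈ W, x ∈ W ⊔ W.map (a 0) := fun x hx => Submodule.mem_sup_left hx
  have inr : ∀ x ∈ W, a 0 x ∈ W ⊔ W.map (a 0) :=
    fun x hx => Submodule.mem_sup_right ⟨x, hx, rfl⟩
  have e2' : ∀ x, a 0 (a 0 x) = x := fun x => LinearMap.congr_fun e2 x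
  have hf : ∀ x ∈ W, b 0 x = a 0 x := fun x hx => by
    have h1 : a 0 (b 0 x) = x := hWE hx
    rw [← e2' (b 0 x), h1]
  refine ⟨W ⊔ W.map (a 0), by rw [finrank_sup_map_involution _ _ e2 wt W hWE, hd], ?_, ?_⟩
  · refine Fin.cases (mapsTo_sup_map inr fun x hx => ?_) fun i =>
      mapsTo_sup_map (fun x hx => inl _ (hWa i x hx)) fun x hx => ?_
    · rw [e2']
      exact inl x hx
    · rw [apply_eq_neg_of_anticomm (ea i)]
      exact neg_mem (inr _ (hWa i x hx))
  · refine Fin.cases (mapsTo_sup_map (fun x hx => ?_) fun x hx => ?_) fun i =>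
      mapsTo_sup_map (fun x hx => inl _ (hWb i x hx)) fun x hx => ?_
    · rw [hf x hx]
      exact inr x hx
    · rw [apply_eq_neg_of_anticomm ef', hf x hx, e2']
      exact neg_mem (inl x hx)
    · rw [apply_eq_neg_of_anticomm (eb' i)]
      exact neg_mem (inr _ (hWb i x hx))

theorem mul_mul_of_commute {R : Type*} [Ring R] {g h J : R} (hJ : J * J = -1)
    (hc : Commute J h) : g * J * (h * J) = -(g * h) := by
  rw [mul_assoc, ← mul_assoc J, hc.eq, mul_assoc h, hJ, mul_neg, mul_neg, mul_one]

theorem mul_mul_of_anticomm {R : Type*} [Ring R] {g h J : R} (hJ : J * J = 1)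
    (hc : J * h = -(h * J)) : g * J * (h * J) = -(g * h) := by
  rw [mul_assoc, ← mul_assoc J, hc, neg_mul, mul_assoc h, hJ, mul_one, mul_neg]

theorem HasSubrep.swap_add_two {p q d : ℕ} (h : HasSubrep q p d) :
    HasSubrep (p + 2) q (2 * d) := by
  intro V _ _ _ _ a b hab
  let a' : Fin p → Module.End ℝ V := fun i => a i.succ.succ
  have e2 := hab.sq_pos 0
  have t2 := hab.sq_pos 1
  have a0 : ∀ i, a 0 * a' i = -(a' i * a 0) := fun i => hab.anti_pos _ _ (Fin.succ_ne_zero _).symm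
  have a1 : ∀ i, a 1 * a' i = -(a' i * a 1) := fun i =>
    hab.anti_pos _ _ fun h => by
      have := congrArg Fin.val h
      simp at this
  have aa : ∀ i j, i ≠ j → a' i * a' j = -(a' j * a' i) := fun i j hij =>
    hab.anti_pos _ _ fun h => hij (Fin.succ_injective _ (Fin.succ_injective _ h))
  have ab : ∀ i j, a' i * b j = -(b j * a' i) := fun i j => hab.anti_mix _ _
  set J := a 0 * a 1 with hJdef
  have et : a 0 * a 1 = -(a 1 * a 0) := hab.anti_pos _ _ (by simp)
  have J2 : J * J = -1 := by
    rw [hJdef, mul_assoc, et, mul_neg, ← mul_assoc (a 1), t2, one_mul, mul_neg, e2]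
  have Ja : ∀ i, Commute J (a' i) := fun i => commute_mul_of_anticomm (a0 i) (a1 i)
  have Jb : ∀ i, Commute J (b i) := fun i =>
    commute_mul_of_anticomm (hab.anti_mix _ _) (hab.anti_mix _ _)
  have eJ : a 0 * J = -(J * a 0) := by rw [hJdef, mul_assoc, ← mul_neg, ← et]
  have tJ : a 1 * J = -(J * a 1) := by rw [hJdef, ← mul_assoc, ← neg_mul, et, neg_neg]
  have comm : ∀ c g : Module.End ℝ V, c * J = -(J * c) → c * g = -(g * c) →
      Commute c (g * J) := fun c g hc hg => by
    refine (commute_mul_of_anticomm (e := g) (f := J) ?_ ?_).symm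
    · rw [hg, neg_neg]
    · rw [hc, neg_neg]
  have ec : ∀ i, Commute (a 0) (a' i * J) := fun i => comm _ _ eJ (a0 i)
  have ed : ∀ i, Commute (a 0) (b i * J) := fun i => comm _ _ eJ (hab.anti_mix _ _)
  have tc : ∀ i, Commute (a 1) (a' i * J) := fun i => comm _ _ tJ (a1 i)
  have td : ∀ i, Commute (a 1) (b i * J) := fun i => comm _ _ tJ (hab.anti_mix _ _)
  obtain ⟨W, hWE, hd, hWb, hWa⟩ := h.exists_le (fun i => b i * J) (fun i => a' i * J) _
    (eqLocus_involution_ne_bot _ _ e2 t2 et)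
    (fun i => mapsTo_eqLocus_of_commute (ed i))
    (fun i => mapsTo_eqLocus_of_commute (ec i))
    (fun i x _ => LinearMap.congr_fun (show b i * J * (b i * J) = 1 by
      rw [mul_mul_of_commute J2 (Jb i), hab.sq_neg, neg_neg]) x)
    (fun i x _ => LinearMap.congr_fun (show a' i * J * (a' i * J) = -1 by
      rw [mul_mul_of_commute J2 (Ja i), hab.sq_pos]) x)
    (fun i j hij x _ => apply_eq_neg_of_anticomm (by
      rw [mul_mul_of_commute J2 (Jb j), mul_mul_of_commute J2 (Jb i), hab.anti_neg i j hij]) x)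
    (fun i j hij x _ => apply_eq_neg_of_anticomm (by
      rw [mul_mul_of_commute J2 (Ja j), mul_mul_of_commute J2 (Ja i), aa i j hij]) x)
    (fun i j x _ => apply_eq_neg_of_anticomm (by
      rw [mul_mul_of_commute J2 (Jb i), mul_mul_of_commute J2 (Ja j), ab j i, neg_neg]) x)
  have e2' : ∀ x ∈ W, a 0 x = x := fun x hx => hWE hx
  have t2' : ∀ x, a 1 (a 1 x) = x := fun x => LinearMap.congr_fun t2 x
  have inl : ∀ x ∈ W, x ∈ W ⊔ W.map (a 1) := fun x hx => Submodule.mem_sup_left hx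
  have inr : ∀ x ∈ W, a 1 x ∈ W ⊔ W.map (a 1) :=
    fun x hx => Submodule.mem_sup_right ⟨x, hx, rfl⟩
  have ext : ∀ g : Module.End ℝ V, Commute (a 1) (g * J) → (∀ x ∈ W, (g * J) x ∈ W) →
      ∀ x ∈ W ⊔ W.map (a 1), g x ∈ W ⊔ W.map (a 1) := by
    intro g hc hg
    have Jt : ∀ x ∈ W, J (a 1 x) = x := fun x hx => by
      rw [hJdef, Module.End.mul_apply, t2', e2' x hx]
    have gt : ∀ x ∈ W, g x ∈ W.map (a 1) := fun x hx => by
      refine ⟨_, hg x hx, ?_⟩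
      have h1 : a 1 ((g * J) x) = (g * J) (a 1 x) := LinearMap.congr_fun hc.eq x
      rw [h1, Module.End.mul_apply, Jt x hx]
    refine mapsTo_sup_map (fun x hx => Submodule.mem_sup_right (gt x hx)) fun x hx => ?_
    have h2 : J x = -a 1 x := by
      rw [hJdef, Module.End.mul_apply, apply_eq_neg_of_anticomm et, e2' x hx]
    have h3 : g (a 1 x) = -(g * J) x := by rw [Module.End.mul_apply, h2, map_neg, neg_neg]
    rw [h3]
    exact neg_mem (inl _ (hg x hx))
  refine ⟨W ⊔ W.map (a 1), by rw [finrank_sup_map_involution _ _ t2 et W hWE, hd],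
    Fin.cases (mapsTo_sup_map (fun x hx => ?_) fun x hx => ?_)
      (Fin.cases (mapsTo_sup_map inr fun x hx => ?_) fun i => ext _ (tc i) (hWa i)),
    fun i => ext _ (td i) (hWb i)⟩
  · rw [e2' x hx]
    exact inl x hx
  · rw [apply_eq_neg_of_anticomm et, e2' x hx]
    exact neg_mem (inr x hx)
  · exact (t2' x).symm ▸ inl x hx

theorem HasSubrep.add_four {p q d : ℕ} (h : HasSubrep p (q + 4) d) : HasSubrep (p + 4) q d := by
  intro V _ _ _ _ a b hab
  let x : Fin 4 → Module.End ℝ V := fun i => a (Fin.natAdd p i)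
  let a' : Fin p → Module.End ℝ V := fun i => a (Fin.castAdd 4 i)
  have xx : ∀ i j, i ≠ j → x i * x j = -(x j * x i) := fun i j hij =>
    hab.anti_pos _ _ fun h => hij (Fin.natAdd_injective _ _ h)
  have xa : ∀ i j, x i * a' j = -(a' j * x i) := fun i j =>
    hab.anti_pos _ _ fun h => by
      have := congrArg Fin.val h
      simp at this
      omega
  have aa : ∀ i j, i ≠ j → a' i * a' j = -(a' j * a' i) := fun i j hij =>
    hab.anti_pos _ _ fun h => hij (Fin.castAdd_injective _ _ h)
  have x2 : ∀ i, x i * x i = 1 := fun i => hab.sq_pos _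
  set η := x 0 * x 1 * (x 2 * x 3) with hη
  have comm : ∀ g, (∀ i, x i * g = -(g * x i)) → Commute η g := fun g hg =>
    (commute_mul_of_anticomm (hg 0) (hg 1)).mul_left (commute_mul_of_anticomm (hg 2) (hg 3))
  have anti : ∀ {s t : Module.End ℝ V}, s * t = -(t * s) → ∀ u, s * (t * u) = -(t * (s * u)) :=
    fun h u => by rw [← mul_assoc, h, neg_mul, mul_assoc]
  have h10 := xx 1 0 (by simp)
  have h20 := xx 2 0 (by simp)
  have h30 := xx 3 0 (by simp)
  have h21 := xx 2 1 (by simp)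
  have h31 := xx 3 1 (by simp)
  have h32 := xx 3 2 (by simp)
  have sq : ∀ i u, x i * (x i * u) = u := fun i u => by rw [← mul_assoc, x2, one_mul]
  have η2 : η * η = 1 := by
    simp only [hη, mul_assoc, x2, anti h10, anti h20, anti h30, anti h21, anti h31, anti h32,
      mul_neg, neg_neg, mul_one]
  have ηx : ∀ i, η * x i = -(x i * η) := by
    intro i
    fin_cases i <;>
    simp [hη, mul_assoc, sq, x2, h30, h31, h32, anti h10, anti h20, anti h30, anti h21, anti h31,
      anti h32]
  have yy : ∀ i j, x i * η * (x j * η) = -(x i * x j) := fun i j => mul_mul_of_anticomm η2 (ηx j)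
  have yg : ∀ i g, (∀ i, x i * g = -(g * x i)) → x i * η * g = -(g * (x i * η)) := fun i g hg => by
    rw [mul_assoc, (comm g hg).eq, ← mul_assoc, hg, neg_mul, mul_assoc]
  have xb : ∀ i j, x i * b j = -(b j * x i) := fun i j => hab.anti_mix _ _
  obtain ⟨W, hd, hWa, hWb⟩ := h V a' (Fin.append b fun i => x i * η)
    { sq_pos := fun i => hab.sq_pos _
      sq_neg := Fin.addCases (fun i => by simpa using hab.sq_neg i) fun i => by simp [yy, x2]
      anti_pos := aa
      anti_neg := by
        refine Fin.addCases (fun i => Fin.addCases (fun j hij => ?_) fun j _ => ?_)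
          fun i => Fin.addCases (fun j _ => ?_) fun j hij => ?_
        · simpa using hab.anti_neg i j fun h => hij (by rw [h])
        · simpa using (neg_eq_iff_eq_neg.mpr (yg j (b i) fun k => xb k i)).symm
        · simpa using yg i (b j) fun k => xb k j
        · simpa [yy, neg_eq_iff_eq_neg] using xx i j fun h => hij (by rw [h])
      anti_mix := fun i => Fin.addCases (fun j => by simpa using hab.anti_mix _ j) fun j => by
        simpa using (neg_eq_iff_eq_neg.mpr (yg j (a' i) fun k => xa k i)).symm }
  have hy : ∀ i, ∀ v ∈ W, (x i * η) v ∈ W := fun i => by simpa using hWb (Fin.natAdd q i)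
  have hxx : ∀ i j, ∀ v ∈ W, (x i * x j) v ∈ W := fun i j v hv => by
    have : x i * x j = -((x i * η) * (x j * η)) := by rw [yy, neg_neg]
    rw [this]
    exact neg_mem (hy i _ (hy j v hv))
  have hηW : ∀ v ∈ W, η v ∈ W := fun v hv => hxx 0 1 _ (hxx 2 3 v hv)
  refine ⟨W, hd, Fin.addCases hWa fun i v hv => ?_, fun i => by simpa using hWb (Fin.castAdd 4 i)⟩
  have : a (Fin.natAdd p i) = x i * η * η := by rw [mul_assoc, η2, mul_one]
  rw [this]
  exact hy i _ (hηW v hv)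



theorem exists_eigenvector_of_involution [Nontrivial V] (w : Module.End ℝ V) (hw : w * w = 1) :
    ∃ v ≠ 0, ∃ c : ℝ, w v = c • v := by
  obtain ⟨u, hu⟩ := exists_ne (0 : V)
  by_cases h : u + w u = 0
  · exact ⟨u, hu, -1, by rw [neg_one_smul]; exact eq_neg_of_add_eq_zero_right h⟩
  · have h2 : w (w u) = u := LinearMap.congr_fun hw u
    exact ⟨_, h, 1, by rw [map_add, h2, one_smul, add_comm]⟩

theorem hasSubrep_zero_zero : HasSubrep 0 0 1 := by
  intro V _ _ _ _ a b _
  obtain ⟨v, hv⟩ := exists_ne (0 : V)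
  exact ⟨ℝ ∙ v, finrank_span_singleton hv, fun i => i.elim0, fun i => i.elim0⟩

theorem hasSubrep_one_zero : HasSubrep 1 0 1 := by
  intro V _ _ _ _ a b hab
  obtain ⟨v, hv, c, hc⟩ := exists_eigenvector_of_involution (a 0) (hab.sq_pos 0)
  refine ⟨ℝ ∙ v, finrank_span_singleton hv, fun i x hx => ?_, fun i => i.elim0⟩
  obtain ⟨r, rfl⟩ := Submodule.mem_span_singleton.mp hx
  rw [Subsingleton.elim i 0, map_smul, hc]
  exact Submodule.smul_mem _ _ (Submodule.smul_mem _ _ (Submodule.mem_span_singleton_self v))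

theorem mapsTo_span_range {n : ℕ} {u : Fin n → V} {g : Module.End ℝ V}
    (h : ∀ k, g (u k) ∈ Submodule.span ℝ (Set.range u)) :
    ∀ x ∈ Submodule.span ℝ (Set.range u), g x ∈ Submodule.span ℝ (Set.range u) := by
  intro x hx
  refine (Submodule.span_le (p := (Submodule.span ℝ (Set.range u)).comap g)).mpr ?_ hx
  rintro _ ⟨k, rfl⟩
  exact h k

theorem hasSubrep_zero_one : HasSubrep 0 1 2 := by
  intro V _ _ _ _ a b hab
  obtain ⟨v, hv⟩ := exists_ne (0 : V)
  have b2 : ∀ x, b 0 (b 0 x) = -x := fun x => LinearMap.congr_fun (hab.sq_neg 0) x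
  have hli : LinearIndependent ℝ ![v, b 0 v] := by
    rw [Fintype.linearIndependent_iff]
    intro g hg
    simp only [Fin.sum_univ_two, Matrix.cons_val_zero, Matrix.cons_val_one] at hg
    have hb := congrArg (b 0) hg
    simp only [map_add, map_smul, b2, map_zero] at hb
    have hN : (g 0 ^ 2 + g 1 ^ 2) • v = 0 := by
      linear_combination (norm := module) g 0 • hg - g 1 • hb
    have hN' := (smul_eq_zero.mp hN).resolve_right hv
    intro i
    fin_cases i <;> simp <;> nlinarith [sq_nonneg (g 0), sq_nonneg (g 1)]
  have hmem : ∀ k, ![v, b 0 v] k ∈ Submodule.span ℝ (Set.range ![v, b 0 v]) :=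
    fun k => Submodule.subset_span ⟨k, rfl⟩
  refine ⟨Submodule.span ℝ (Set.range ![v, b 0 v]), by simpa using finrank_span_eq_card hli,
    fun i => i.elim0, fun i => mapsTo_span_range fun k => ?_⟩
  rw [Subsingleton.elim i 0]
  fin_cases k
  · exact hmem 1
  · exact (b2 v).symm ▸ neg_mem (hmem 0)

/-- The orbit of a nonzero vector under anticommuting complex structures `i`, `j`. -/
theorem linearIndependent_quaternionic (i j : Module.End ℝ V) (hi : i * i = -1) (hj : j * j = -1)
    (hij : j * i = -(i * j)) {v : V} (hv : v ≠ 0) :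
    LinearIndependent ℝ ![v, i v, j v, i (j v)] := by
  have i2 : ∀ x, i (i x) = -x := fun x => LinearMap.congr_fun hi x
  have j2 : ∀ x, j (j x) = -x := fun x => LinearMap.congr_fun hj x
  have ji : ∀ x, j (i x) = -i (j x) := apply_eq_neg_of_anticomm hij
  rw [Fintype.linearIndependent_iff]
  intro g hg
  simp only [Fin.sum_univ_four, Matrix.cons_val] at hg
  have h1 := congrArg i hg
  have h2 := congrArg j hg
  have h3 := congrArg j h1
  simp only [map_add, map_smul, i2, j2, ji, map_zero, map_neg] at h1 h2 h3
  have hN : (g 0 ^ 2 + g 1 ^ 2 + g 2 ^ 2 + g 3 ^ 2) • v = 0 := by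
    linear_combination (norm := module) g 0 • hg - g 1 • h1 - g 2 • h2 + g 3 • h3
  have hN' := (smul_eq_zero.mp hN).resolve_right hv
  intro k
  fin_cases k <;> simp <;>
    nlinarith [sq_nonneg (g 0), sq_nonneg (g 1), sq_nonneg (g 2), sq_nonneg (g 3)]

theorem mapsTo_quaternionic (i j : Module.End ℝ V) (hi : i * i = -1) (hj : j * j = -1)
    (hij : j * i = -(i * j)) (v : V) :
    (∀ x ∈ Submodule.span ℝ (Set.range ![v, i v, j v, i (j v)]),
      i x ∈ Submodule.span ℝ (Set.range ![v, i v, j v, i (j v)])) ∧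
    ∀ x ∈ Submodule.span ℝ (Set.range ![v, i v, j v, i (j v)]),
      j x ∈ Submodule.span ℝ (Set.range ![v, i v, j v, i (j v)]) := by
  have i2 : ∀ x, i (i x) = -x := fun x => LinearMap.congr_fun hi x
  have j2 : ∀ x, j (j x) = -x := fun x => LinearMap.congr_fun hj x
  have ji : ∀ x, j (i x) = -i (j x) := apply_eq_neg_of_anticomm hij
  have hmem : ∀ k, ![v, i v, j v, i (j v)] k ∈
      Submodule.span ℝ (Set.range ![v, i v, j v, i (j v)]) :=
    fun k => Submodule.subset_span ⟨k, rfl⟩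
  constructor
  · refine mapsTo_span_range fun k => ?_
    fin_cases k
    · exact hmem 1
    · exact (i2 v).symm ▸ neg_mem (hmem 0)
    · exact hmem 3
    · exact (i2 (j v)).symm ▸ neg_mem (hmem 2)
  · refine mapsTo_span_range fun k => ?_
    fin_cases k
    · exact hmem 2
    · exact (ji v).symm ▸ neg_mem (hmem 3)
    · exact (j2 v).symm ▸ neg_mem (hmem 0)
    · have : j (i (j v)) = i v := by rw [ji, j2, map_neg, neg_neg]
      exact this.symm ▸ hmem 1

theorem hasSubrep_zero_two : HasSubrep 0 2 4 := by
  intro V _ _ _ _ a b hab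
  obtain ⟨v, hv⟩ := exists_ne (0 : V)
  have hba : b 1 * b 0 = -(b 0 * b 1) := hab.anti_neg _ _ (by simp)
  have hW := mapsTo_quaternionic (b 0) (b 1) (hab.sq_neg 0) (hab.sq_neg 1) hba v
  refine ⟨_, ?_, fun i => i.elim0, Fin.forall_fin_two.mpr hW⟩
  simpa using finrank_span_eq_card
    (linearIndependent_quaternionic (b 0) (b 1) (hab.sq_neg 0) (hab.sq_neg 1) hba hv)

theorem hasSubrep_zero_three : HasSubrep 0 3 4 := by
  intro V _ _ _ _ a b hab
  have hba : b 1 * b 0 = -(b 0 * b 1) := hab.anti_neg _ _ (by simp)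
  have hca : b 2 * b 0 = -(b 0 * b 2) := hab.anti_neg _ _ (by simp)
  have hcb : b 2 * b 1 = -(b 1 * b 2) := hab.anti_neg _ _ (by simp)
  have a2 : ∀ x, b 0 (b 0 x) = -x := fun x => LinearMap.congr_fun (hab.sq_neg 0) x
  have b2 : ∀ x, b 1 (b 1 x) = -x := fun x => LinearMap.congr_fun (hab.sq_neg 1) x
  have c2 : ∀ x, b 2 (b 2 x) = -x := fun x => LinearMap.congr_fun (hab.sq_neg 2) x
  have ba : ∀ x, b 1 (b 0 x) = -b 0 (b 1 x) := apply_eq_neg_of_anticomm hba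
  have ca : ∀ x, b 2 (b 0 x) = -b 0 (b 2 x) := apply_eq_neg_of_anticomm hca
  have cb : ∀ x, b 2 (b 1 x) = -b 1 (b 2 x) := apply_eq_neg_of_anticomm hcb
  obtain ⟨v, hv, r, hr⟩ := exists_eigenvector_of_involution (b 0 * b 1 * b 2) (by
    ext x
    simp only [Module.End.mul_apply, Module.End.one_apply, a2, b2, c2, ba, ca, cb, map_neg,
      neg_neg])
  have hcv : b 2 v = -r • b 0 (b 1 v) := by
    have h1 := congrArg (b 1) (congrArg (b 0) hr)
    simp only [Module.End.mul_apply, a2, b2, map_neg, neg_neg, map_smul, ba] at h1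
    rw [h1, smul_neg, neg_smul]
  have hW := mapsTo_quaternionic (b 0) (b 1) (hab.sq_neg 0) (hab.sq_neg 1) hba v
  have hmem : ∀ k, ![v, b 0 v, b 1 v, b 0 (b 1 v)] k ∈
      Submodule.span ℝ (Set.range ![v, b 0 v, b 1 v, b 0 (b 1 v)]) :=
    fun k => Submodule.subset_span ⟨k, rfl⟩
  have hc : b 2 v ∈ Submodule.span ℝ (Set.range ![v, b 0 v, b 1 v, b 0 (b 1 v)]) :=
    hcv ▸ Submodule.smul_mem _ _ (hmem 3)
  have hc2 : ∀ x ∈ Submodule.span ℝ (Set.range ![v, b 0 v, b 1 v, b 0 (b 1 v)]),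
      b 2 x ∈ Submodule.span ℝ (Set.range ![v, b 0 v, b 1 v, b 0 (b 1 v)]) := by
    refine mapsTo_span_range fun k => ?_
    fin_cases k
    · exact hc
    · exact (ca v).symm ▸ neg_mem (hW.1 _ hc)
    · exact (cb v).symm ▸ neg_mem (hW.2 _ hc)
    · exact (ca (b 1 v)).symm ▸ neg_mem (hW.1 _ ((cb v).symm ▸ neg_mem (hW.2 _ hc)))
  refine ⟨Submodule.span ℝ (Set.range ![v, b 0 v, b 1 v, b 0 (b 1 v)]), ?_, fun i => i.elim0, fun i => ?_⟩
  · simpa using finrank_span_eq_card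
      (linearIndependent_quaternionic (b 0) (b 1) (hab.sq_neg 0) (hab.sq_neg 1) hba hv)
  · fin_cases i
    exacts [hW.1, hW.2, hc2]

end Subrep

theorem mfun_pos : ∀ n, 0 < mfun n
  | 0 | 1 | 2 | 3 | 4 | 5 | 6 | 7 | 8 => by simp [mfun]
  | n + 9 => by
    have := mfun_pos (n + 1)
    simp only [mfun]
    omega

/-- Clifford systems with `n + 1` members have subsystems of dimension `2 m(n)`. -/
theorem hasSubrep_mfun : ∀ n, 1 ≤ n → HasSubrep (n + 1) 0 (2 * mfun n)
  | 0, h => absurd h (by simp)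
  | 1, _ => hasSubrep_zero_zero.swap_add_two
  | 2, _ => hasSubrep_zero_one.swap_add_two
  | 3, _ => hasSubrep_zero_two.swap_add_two
  | 4, _ => hasSubrep_zero_three.succ_succ.add_four
  | 5, _ => hasSubrep_zero_two.succ_succ.succ_succ.add_four
  | 6, _ => hasSubrep_zero_one.succ_succ.succ_succ.succ_succ.add_four
  | 7, _ => hasSubrep_zero_zero.succ_succ.succ_succ.succ_succ.succ_succ.add_four
  | 8, _ => hasSubrep_one_zero.succ_succ.succ_succ.succ_succ.succ_succ.add_four
  | n + 9, _ => by
    have h := (hasSubrep_mfun (n + 1) (by simp)).succ_succ.succ_succ.succ_succ.succ_succ.add_four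
    rw [show 2 * mfun (n + 9) = 2 * (2 * (2 * (2 * (2 * mfun (n + 1))))) by
      simp only [mfun]; ring]
    exact h

section QuadraticForm

variable {m : ℕ}

theorem dotProduct_mulVec_comm_of_isSymm {ι : Type*} [Fintype ι] {A : Matrix ι ι ℝ}
    (hA : A.IsSymm) (x y : ι → ℝ) : x ⬝ᵥ A *ᵥ y = A *ᵥ x ⬝ᵥ y := by
  rw [dotProduct_mulVec, ← mulVec_transpose, hA.eq]

theorem dotProduct_mulVec_add_smul {A : Matrix (Fin m) (Fin m) ℝ} (hA : A.IsSymm)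
    (x v : Fin m → ℝ) (t : ℝ) : (x + t • v) ⬝ᵥ A *ᵥ (x + t • v) =
      x ⬝ᵥ A *ᵥ x + t * (2 * (v ⬝ᵥ A *ᵥ x)) + t ^ 2 * (v ⬝ᵥ A *ᵥ v) := by
  have : x ⬝ᵥ A *ᵥ v = v ⬝ᵥ A *ᵥ x := by
    rw [dotProduct_mulVec_comm_of_isSymm hA, dotProduct_comm]
  simp only [mulVec_add, mulVec_smul, dotProduct_add, add_dotProduct, smul_dotProduct,
    dotProduct_smul, smul_eq_mul, this]
  ring

theorem eq_of_dotProduct_mulVec_eq {A B : Matrix (Fin m) (Fin m) ℝ} (hA : A.IsSymm)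
    (hB : B.IsSymm) (h : ∀ x, x ⬝ᵥ A *ᵥ x = x ⬝ᵥ B *ᵥ x) : A = B := by
  ext i j
  have h1 := h (Pi.single j 1 + (1 : ℝ) • Pi.single i 1)
  rw [dotProduct_mulVec_add_smul hA, dotProduct_mulVec_add_smul hB, h, h] at h1
  simpa using h1

theorem pderiv_dotProduct_mulVec {A : Matrix (Fin m) (Fin m) ℝ} (hA : A.IsSymm) (i : Fin m)
    (x : Fin m → ℝ) : pderiv i (fun y => y ⬝ᵥ A *ᵥ y) x = 2 * (A *ᵥ x) i := by
  have hd : DifferentiableAt ℝ (fun y : Fin m → ℝ => y ⬝ᵥ A *ᵥ y) x := by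
    simp only [dotProduct, mulVec]
    fun_prop
  rw [pderiv, ← hd.lineDeriv_eq_fderiv]
  refine HasLineDerivAt.lineDeriv ?_
  simp only [HasLineDerivAt, dotProduct_mulVec_add_smul hA]
  have h := (((hasDerivAt_id (0 : ℝ)).mul_const (2 * (Pi.single i 1 ⬝ᵥ A *ᵥ x))).const_add
    (x ⬝ᵥ A *ᵥ x)).add (((hasDerivAt_id (0 : ℝ)).pow 2).mul_const
      ((Pi.single i 1 : Fin m → ℝ) ⬝ᵥ A *ᵥ Pi.single i 1))
  convert h using 1
  · ext t
    simp
  · simp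

theorem pderiv_mulVec (A : Matrix (Fin m) (Fin m) ℝ) (i : Fin m) (x : Fin m → ℝ) :
    pderiv i (fun y => 2 * (A *ᵥ y) i) x = 2 * A i i := by
  have hd : DifferentiableAt ℝ (fun y : Fin m → ℝ => 2 * (A *ᵥ y) i) x := by
    simp only [dotProduct, mulVec]
    fun_prop
  rw [pderiv, ← hd.lineDeriv_eq_fderiv]
  refine HasLineDerivAt.lineDeriv ?_
  unfold HasLineDerivAt
  have h := ((hasDerivAt_id (0 : ℝ)).mul_const (2 * A i i)).const_add (2 * (A *ᵥ x) i)
  convert h using 1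
  · ext t
    simp [mulVec_add, mulVec_smul]
    ring
  · simp

theorem isHarmonicMorphism_iff {n : ℕ} {A : Fin n → Matrix (Fin m) (Fin m) ℝ}
    {φ : (Fin m → ℝ) → Fin n → ℝ} (hA : ∀ α, (A α).IsSymm)
    (hφ : ∀ x α, φ x α = x ⬝ᵥ A α *ᵥ x) :
    IsHarmonicMorphism φ ↔ (∀ α, (A α).trace = 0) ∧ ∃ lam : (Fin m → ℝ) → ℝ, ∀ x α β,
      4 * (A α *ᵥ x ⬝ᵥ A β *ᵥ x) = lam x ^ 2 * (if α = β then 1 else 0) := by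
  have h1 : ∀ α i, pderiv i (fun y => φ y α) = fun y => 2 * (A α *ᵥ y) i := fun α i => by
    simp only [hφ]
    exact funext (pderiv_dotProduct_mulVec (hA α) i)
  simp only [IsHarmonicMorphism, h1, pderiv_mulVec, ← Finset.mul_sum]
  refine and_congr (forall_congr' fun α => ?_) (exists_congr fun lam => forall_congr' fun x =>
    forall_congr' fun α => forall_congr' fun β => ?_)
  · simp [Matrix.trace]
  · rw [dotProduct, Finset.mul_sum]
    simp only [show ∀ a b : ℝ, 2 * a * (2 * b) = 4 * (a * b) from fun a b => by ring]

theorem Represents.unique {n : ℕ} {A B : Fin n → Matrix (Fin m) (Fin m) ℝ}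
    {φ : (Fin m → ℝ) → Fin n → ℝ} (hA : Represents A φ) (hB : Represents B φ) : A = B :=
  funext fun α => eq_of_dotProduct_mulVec_eq (hA.1 α) (hB.1 α) fun x =>
    (hA.2.2 x α).symm.trans (hB.2.2 x α)

theorem Represents.mul_relations {n : ℕ} {A : Fin n → Matrix (Fin m) (Fin m) ℝ}
    {φ : (Fin m → ℝ) → Fin n → ℝ} (hA : Represents A φ) (hφ : IsHarmonicMorphism φ) :
    (∀ α β, A α * A α = A β * A β) ∧ ∀ α β, α ≠ β → A α * A β = -(A β * A α) := by
  obtain ⟨lam, hlam⟩ := ((isHarmonicMorphism_iff hA.1 hA.2.2).mp hφ).2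
  have hT := fun α => (hA.1 α).eq
  have hmul : ∀ α β x, x ⬝ᵥ (A α * A β) *ᵥ x = A α *ᵥ x ⬝ᵥ A β *ᵥ x := fun α β x => by
    rw [← mulVec_mulVec, dotProduct_mulVec_comm_of_isSymm (hA.1 α)]
  have hsymm : ∀ α, (A α * A α).IsSymm := fun α => by
    rw [Matrix.IsSymm, transpose_mul, hT]
  constructor
  · intro α β
    refine eq_of_dotProduct_mulVec_eq (hsymm α) (hsymm β) fun x => ?_
    have h1 := hlam x α α
    have h2 := hlam x β β
    rw [if_pos rfl] at h1 h2
    rw [hmul, hmul]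
    linarith
  · intro α β hαβ
    refine eq_neg_of_add_eq_zero_left (eq_of_dotProduct_mulVec_eq ?_ isSymm_zero fun x => ?_)
    · rw [Matrix.IsSymm, transpose_add, transpose_mul, transpose_mul, hT, hT, add_comm]
    · have h1 := hlam x α β
      have h2 := hlam x β α
      rw [if_neg hαβ] at h1
      rw [if_neg hαβ.symm] at h2
      rw [add_mulVec, dotProduct_add, hmul, hmul]
      simp
      linarith

end QuadraticForm

section CliffordSystem

variable {N n : ℕ} {P : Fin n → Matrix (Fin N) (Fin N) ℝ}

theorem isCliffordSystem_iff : IsCliffordSystem P ↔ (∀ i, (P i).IsSymm) ∧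
    (∀ i, P i * P i = 1) ∧ ∀ i j, i ≠ j → P i * P j = -(P j * P i) := by
  refine and_congr_right fun _ => ⟨fun h => ⟨fun i => ?_, fun i j hij => ?_⟩, fun h i j => ?_⟩
  · have := h i i
    rw [if_pos rfl, ← two_smul ℝ] at this
    exact smul_right_injective _ two_ne_zero this
  · have := h i j
    rw [if_neg hij] at this
    exact eq_neg_of_add_eq_zero_left this
  · split_ifs with hij
    · rw [hij, h.1, two_smul]
    · rw [h.2 i j hij, neg_add_cancel]

theorem HasEigen.swap {A B : Matrix (Fin N) (Fin N) ℝ} {μ : ℝ} (hB : IsUnit B)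
    (hAB : A * B = -(B * A)) (h : HasEigen A μ) : HasEigen A (-μ) := by
  obtain ⟨v, hv, hμ⟩ := h
  refine ⟨B *ᵥ v, fun h0 => hv (mulVec_injective_iff_isUnit.mpr hB ?_), ?_⟩
  · rw [h0, mulVec_zero]
  · rw [mulVec_mulVec, hAB, neg_mulVec, ← mulVec_mulVec, hμ, mulVec_smul, neg_smul]

theorem trace_eq_zero_of_anticomm {ι : Type*} [Fintype ι] [DecidableEq ι]
    {A B : Matrix ι ι ℝ} (hB : B * B = 1) (hAB : A * B = -(B * A)) : A.trace = 0 := by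
  have h : A.trace = -A.trace := by
    conv_lhs => rw [← Matrix.mul_one A, ← hB, ← Matrix.mul_assoc, hAB, Matrix.neg_mul, trace_neg,
      trace_mul_cycle, hB, Matrix.one_mul]
  linarith

theorem IsCliffordSystem.memH21 (hP : IsCliffordSystem P) (hN : 0 < N) (hn : 2 ≤ n) :
    MemH21 (cliffordMap P) ∧ QNonsingular (cliffordMap P) ∧ Umbilical (cliffordMap P) := by
  obtain ⟨hS, hsq, hac⟩ := isCliffordSystem_iff.mp hP
  have : NeZero N := ⟨hN.ne'⟩
  have : Nontrivial (Fin n) := Fin.nontrivial_iff_two_le.mpr hn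
  have hU : ∀ i, IsUnit (P i) := fun i => IsUnit.of_mul_eq_one _ (hsq i)
  have hrep : Represents P (cliffordMap P) := ⟨hS, fun i => (hU i).ne_zero, fun _ _ => rfl⟩
  have hev : ∀ i μ, 0 < μ → HasEigen (P i) μ → μ = 1 := by
    rintro i μ hμ ⟨v, hv, h⟩
    have h2 : v = (μ * μ) • v := by
      conv_lhs => rw [← one_mulVec v, ← hsq i, ← mulVec_mulVec, h, mulVec_smul, h, smul_smul]
    have h3 : (μ * μ - 1) • v = 0 := by rw [sub_smul, ← h2, one_smul, sub_self]
    have := (smul_eq_zero.mp h3).resolve_right hv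
    nlinarith
  have hone : ∀ i, HasEigen (P i) 1 := by
    intro i
    obtain ⟨j, hj⟩ := exists_ne i
    obtain ⟨v, hv⟩ := exists_ne (0 : Fin N → ℝ)
    by_cases h : v + P i *ᵥ v = 0
    · have := HasEigen.swap (hU j) (hac i j hj.symm) (μ := -1)
        ⟨v, hv, by rw [neg_one_smul]; exact eq_neg_of_add_eq_zero_right h⟩
      rwa [neg_neg] at this
    · refine ⟨_, h, ?_⟩
      rw [mulVec_add, mulVec_mulVec, hsq, one_mulVec, one_smul, add_comm]
  refine ⟨⟨⟨⟨P, hrep⟩, ?_⟩, P, hrep, fun i => ⟨hone i, hev i⟩⟩,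
    ⟨P, hrep, fun i => by rw [rank_of_isUnit _ (hU i), Fintype.card_fin]⟩,
    P, hrep, fun i μ ν hμ hν h1 h2 => (hev i μ hμ h1).trans (hev i ν hν h2).symm⟩
  refine (isHarmonicMorphism_iff hS hrep.2.2).mpr ⟨fun i => ?_, fun x => 2 * √(x ⬝ᵥ x),
    fun x i j => ?_⟩
  · obtain ⟨j, hj⟩ := exists_ne i
    exact trace_eq_zero_of_anticomm (hsq j) (hac i j hj.symm)
  · have hmul : ∀ i j, P i *ᵥ x ⬝ᵥ P j *ᵥ x = x ⬝ᵥ (P i * P j) *ᵥ x := fun i j => by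
      rw [← mulVec_mulVec, dotProduct_mulVec_comm_of_isSymm (hS i)]
    have hx : 0 ≤ x ⬝ᵥ x := by simpa using dotProduct_star_self_nonneg x
    split_ifs with hij
    · rw [hij, hmul, hsq, one_mulVec, mul_pow, Real.sq_sqrt hx]
      ring
    · have h1 := hmul i j
      rw [hac i j hij, neg_mulVec, dotProduct_neg, ← hmul, dotProduct_comm] at h1
      have h2 := dotProduct_comm (P j *ᵥ x) (P i *ᵥ x)
      linarith

theorem mulVec_eigenvectorBasis_coe {A : Matrix (Fin N) (Fin N) ℝ} (hA : A.IsHermitian)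
    (i : Fin N) : (hA.eigenvectorBasis i).ofLp ≠ 0 ∧
      A *ᵥ (hA.eigenvectorBasis i).ofLp = hA.eigenvalues i • (hA.eigenvectorBasis i).ofLp := by
  refine ⟨fun h => hA.eigenvectorBasis.toBasis.ne_zero i ?_, hA.mulVec_eigenvectorBasis i⟩
  ext k
  simpa using congrFun h k

/-- A `Q`-nonsingular umbilical quadratic harmonic morphism is a multiple of the quadratic map of
a Clifford system. -/
theorem IsQuadraticHM.exists_cliffordSystem (hn : 2 ≤ n) {φ : (Fin N → ℝ) → Fin n → ℝ}
    (hφ : IsQuadraticHM φ) (hq : QNonsingular φ) (hu : Umbilical φ) :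
    0 < N ∧ ∃ c : ℝ, 0 < c ∧ ∃ P : Fin n → Matrix (Fin N) (Fin N) ℝ, IsCliffordSystem P ∧
      ∀ x, φ x = c • cliffordMap P x := by
  obtain ⟨A, hA, hr⟩ := hq
  obtain ⟨_, hA', hev⟩ := hu
  obtain rfl := hA.unique hA'
  obtain ⟨hsq, hac⟩ := hA.mul_relations hφ.2
  have hU : ∀ i, IsUnit (A i) := fun i => by
    rw [← mulVec_injective_iff_isUnit]
    refine (LinearMap.injective_iff_surjective (f := (A i).mulVecLin)).mpr
      (LinearMap.range_eq_top.mp (Submodule.eq_top_of_finrank_eq ?_))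
    rw [Module.finrank_fin_fun]
    exact hr i
  let i₀ : Fin n := ⟨0, by omega⟩
  let i₁ : Fin n := ⟨1, by omega⟩
  have h01 : i₀ ≠ i₁ := by simp [i₀, i₁]
  have hN : 0 < N := by
    rcases Nat.eq_zero_or_pos N with rfl | h
    · exact absurd (Subsingleton.elim _ _) (hA.2.1 i₀)
    · exact h
  have hH : (A i₀).IsHermitian := hA.1 i₀
  have hne : ∀ k, hH.eigenvalues k ≠ 0 := fun k h => by
    obtain ⟨h1, h2⟩ := mulVec_eigenvectorBasis_coe hH k
    rw [h, zero_smul] at h2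
    exact h1 (mulVec_injective_iff_isUnit.mpr (hU i₀) (h2.trans (mulVec_zero _).symm))
  have habs : ∀ k, HasEigen (A i₀) |hH.eigenvalues k| := fun k => by
    have h : HasEigen (A i₀) (hH.eigenvalues k) := ⟨_, mulVec_eigenvectorBasis_coe hH k⟩
    rcases abs_choice (hH.eigenvalues k) with h1 | h1 <;> rw [h1]
    exacts [h, h.swap (hU i₁) (hac _ _ h01)]
  set c := |hH.eigenvalues ⟨0, hN⟩| with hc
  have hc0 : 0 < c := abs_pos.mpr (hne _)
  have hsq0 : A i₀ * A i₀ = (c * c) • 1 := by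
    refine (toEuclideanLin (𝕜 := ℝ)).injective (hH.eigenvectorBasis.toBasis.ext fun k => ?_)
    have hk : |hH.eigenvalues k| = c :=
      hev i₀ _ _ (abs_pos.mpr (hne k)) hc0 (habs k) (habs _)
    have h2 := (mulVec_eigenvectorBasis_coe hH k).2
    ext l
    rw [OrthonormalBasis.coe_toBasis, toLpLin_apply, toLpLin_apply, ← mulVec_mulVec, h2,
      mulVec_smul, h2, smul_smul, smul_mulVec, one_mulVec, ← hk, abs_mul_abs_self]
  refine ⟨hN, c, hc0, fun i => c⁻¹ • A i, isCliffordSystem_iff.mpr ⟨fun i => (hA.1 i).smul _,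
    fun i => ?_, fun i j hij => ?_⟩, fun x => funext fun i => ?_⟩
  · rw [smul_mul_smul_comm, hsq i i₀, hsq0, smul_smul]
    field_simp
    simp
  · rw [smul_mul_smul_comm, smul_mul_smul_comm, hac i j hij, smul_neg]
  · simp [cliffordMap, hA.2.2 x i, smul_mulVec, hc0.ne']

theorem IsQuadraticHM.two_mul_mfun_le (hn : 1 ≤ n) {φ : (Fin N → ℝ) → Fin (n + 1) → ℝ}
    (hφ : IsQuadraticHM φ) : 2 * mfun n ≤ N := by
  obtain ⟨⟨A, hA⟩, hφ⟩ := hφ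
  obtain ⟨hsq, hac⟩ := hA.mul_relations hφ
  have hH : (A 0).IsHermitian := hA.1 0
  obtain ⟨k, hk⟩ : ∃ k, hH.eigenvalues k ≠ 0 := by
    by_contra! h
    exact hA.2.1 0 (hH.eigenvalues_eq_zero_iff.mp (funext h))
  set μ := hH.eigenvalues k
  obtain ⟨hv, hμ⟩ := mulVec_eigenvectorBasis_coe hH k
  set v := (hH.eigenvectorBasis k).ofLp
  let E : Submodule ℝ (Fin N → ℝ) :=
    LinearMap.eqLocus (A 0 * A 0).mulVecLin ((μ * μ) • LinearMap.id)
  have hE : ∀ x, x ∈ E ↔ ∀ i, A i *ᵥ A i *ᵥ x = (μ * μ) • x := fun x => by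
    simp only [mulVec_mulVec, hsq _ 0, forall_const]
    rfl
  have hmem : ∀ i, ∀ x ∈ E, A i *ᵥ x ∈ E := fun i x hx => (hE _).mpr fun j => by
    rw [mulVec_mulVec, hsq j i, ← mulVec_mulVec, (hE x).mp hx i, mulVec_smul]
  have hvE : v ∈ E := by
    change (A 0 * A 0) *ᵥ v = (μ * μ) • v
    rw [← mulVec_mulVec, hμ, mulVec_smul, hμ, smul_smul]
  obtain ⟨W, -, hW, -⟩ := (hasSubrep_mfun n hn).exists_le (fun i => μ⁻¹ • (A i).mulVecLin)
    (fun i => i.elim0) E ((Submodule.ne_bot_iff _).mpr ⟨v, hvE, hv⟩)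
    (fun i x hx => E.smul_mem _ (hmem i x hx)) (fun i => i.elim0)
    (fun i x hx => by
      simp only [LinearMap.smul_apply, mulVecLin_apply, mulVec_smul, (hE x).mp hx i, smul_smul]
      field_simp
      simp)
    (fun i => i.elim0)
    (fun i j hij x hx => by
      simp only [LinearMap.smul_apply, mulVecLin_apply, mulVec_smul, mulVec_mulVec, hac i j hij,
        neg_mulVec, smul_neg])
    (fun i => i.elim0) (fun i j => j.elim0)
  rw [← hW]
  simpa using W.finrank_le

theorem IsCliffordSystem.domainMinimal (hn : 1 ≤ n)
    {P : Fin (n + 1) → Matrix (Fin (2 * mfun n)) (Fin (2 * mfun n)) ℝ} (hP : IsCliffordSystem P) :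
    MemH21 (cliffordMap P) ∧ DomainMinimal (cliffordMap P) := by
  have h := (hP.memH21 (Nat.mul_pos two_pos (mfun_pos n)) (by omega)).1
  exact ⟨h, h.1, fun M hM ⟨ψ, hψ⟩ => hM.not_ge (hψ.two_mul_mfun_le hn)⟩

end CliffordSystem

section Decomposition

open scoped InnerProductSpace in
/-- A space acted on by a symmetric Clifford system has an orthonormal basis adapted to a
decomposition into invariant subspaces of equal dimension. -/
theorem HasSubrep.exists_orthonormal_blocks {p d : ℕ} (hD : HasSubrep p 0 d) (hd : 0 < d)
    {V : Type} [NormedAddCommGroup V] [InnerProductSpace ℝ V] [FiniteDimensional ℝ V]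
    (e : Fin p → Module.End ℝ V) (hsymm : ∀ i, (e i).IsSymmetric) (hsq : ∀ i x, e i (e i x) = x)
    (hac : ∀ i j, i ≠ j → ∀ x, e i (e j x) = -e j (e i x)) (F : Submodule ℝ V)
    (hF : ∀ i, ∀ x ∈ F, e i x ∈ F) :
    ∃ (k : ℕ) (v : Fin k → Fin d → V), k * d = Module.finrank ℝ F ∧ (∀ j a, v j a ∈ F) ∧
      (∀ j, Orthonormal ℝ (v j)) ∧ (∀ j l, j ≠ l → ∀ a b, ⟪v j a, v l b⟫_ℝ = 0) ∧
      ∀ i j l, j ≠ l → ∀ a b, ⟪v j a, e i (v l b)⟫_ℝ = 0 := by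
  induction hr : Module.finrank ℝ F using Nat.strong_induction_on generalizing F with
  | _ r ih =>
  by_cases hbot : F = ⊥
  · subst hbot
    refine ⟨0, fun j => j.elim0, ?_, fun j => j.elim0, fun j => j.elim0, fun j => j.elim0,
      fun _ j => j.elim0⟩
    rw [← hr, finrank_bot, zero_mul]
  obtain ⟨W, hWF, hWd, hW, -⟩ := hD.exists_le e (fun i => i.elim0) F hbot hF (fun i => i.elim0)
    (fun i x _ => hsq i x) (fun i => i.elim0) (fun i j hij x _ => hac i j hij x)
    (fun i => i.elim0) (fun i j => j.elim0)
  have hsum := Submodule.finrank_add_inf_finrank_orthogonal hWF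
  obtain ⟨k, v, hk, hvF, hon, h0, he0⟩ := ih (Module.finrank ℝ (Wᗮ ⊓ F : Submodule ℝ V)) (by omega)
    (Wᗮ ⊓ F) (fun i x hx => ⟨fun w hw => by rw [← hsymm i]; exact hx.1 _ (hW i w hw),
      hF i x hx.2⟩) rfl
  let w := (stdOrthonormalBasis ℝ W).reindex (finCongr hWd)
  have hwv : ∀ x ∈ W, ∀ j a, ⟪x, v j a⟫_ℝ = 0 := fun x hx j a => (hvF j a).1 x hx
  have hvw : ∀ x ∈ W, ∀ j a, ⟪v j a, x⟫_ℝ = 0 := fun x hx j a => by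
    rw [real_inner_comm, hwv x hx]
  refine ⟨k + 1, Fin.cons (fun a => (w a : V)) v, ?_, ?_, ?_, ?_, ?_⟩
  · rw [add_one_mul, hk]
    omega
  · refine Fin.cases (fun a => hWF (w a).2) fun j a => (hvF j a).2
  · refine Fin.cases ?_ hon
    exact w.orthonormal.comp_linearIsometry W.subtypeₗᵢ
  · refine Fin.cases (Fin.cases (fun h => absurd rfl h) fun l _ a b => ?_) fun j =>
      Fin.cases (fun _ a b => ?_) fun l h => ?_
    · exact hwv _ (w a).2 l b
    · exact hvw _ (w b).2 j a
    · exact h0 j l fun h' => h (congrArg _ h')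
  · refine fun i => Fin.cases (Fin.cases (fun h => absurd rfl h) fun l _ a b => ?_) fun j =>
      Fin.cases (fun _ a b => ?_) fun l h => ?_
    · simp only [Fin.cons_zero, Fin.cons_succ]
      rw [← hsymm i]
      exact hwv _ (hW i _ (w a).2) l b
    · exact hvw _ (hW i _ (w b).2) j a
    · exact he0 i j l fun h' => h (congrArg _ h')

theorem IsCliffordSystem.exists_blocks {M n : ℕ} (hn : 1 ≤ n)
    {P : Fin (n + 1) → Matrix (Fin M) (Fin M) ℝ} (hP : IsCliffordSystem P) :
    ∃ k, M = k * (2 * mfun n) ∧ ∃ (G : Matrix (Fin (2 * mfun n) × Fin k) (Fin M) ℝ)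
      (B : Fin k → Fin (n + 1) → Matrix (Fin (2 * mfun n)) (Fin (2 * mfun n)) ℝ),
      Gᵀ * G = 1 ∧ (∀ j, IsCliffordSystem (B j)) ∧
        ∀ x, cliffordMap P x = ∑ j, cliffordMap (B j) fun a => (G *ᵥ x) (a, j) := by
  obtain ⟨hS, hsq, hac⟩ := isCliffordSystem_iff.mp hP
  obtain ⟨k, v, hk, -, hon, h0, he0⟩ := (hasSubrep_mfun n hn).exists_orthonormal_blocks
    (Nat.mul_pos two_pos (mfun_pos n)) (fun i => toEuclideanLin (P i))
    (fun i => isSymmetric_toEuclideanLin_iff.mpr (hS i))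
    (fun i x => by ext l; simp [toLpLin_apply, mulVec_mulVec, hsq])
    (fun i j hij x => by ext l; simp [toLpLin_apply, mulVec_mulVec, hac i j hij, neg_mulVec])
    ⊤ (fun _ _ _ => Submodule.mem_top)
  rw [finrank_top, finrank_euclideanSpace, Fintype.card_fin] at hk
  let G : Matrix (Fin (2 * mfun n) × Fin k) (Fin M) ℝ := Matrix.of fun p => (v p.2 p.1).ofLp
  let B : Fin k → Fin (n + 1) → Matrix (Fin (2 * mfun n)) (Fin (2 * mfun n)) ℝ := fun j i =>
    Matrix.of fun a b => (v j a).ofLp ⬝ᵥ P i *ᵥ (v j b).ofLp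
  have hGG : G * Gᵀ = 1 := by
    ext ⟨a, j⟩ ⟨b, l⟩
    change (v j a).ofLp ⬝ᵥ (v l b).ofLp = _
    rw [one_apply, dotProduct_comm]
    by_cases hjl : j = l
    · subst hjl
      simpa [PiLp.inner_apply, dotProduct, one_apply] using orthonormal_iff_ite.mp (hon j) a b
    · rw [if_neg (by simp [hjl])]
      simpa [PiLp.inner_apply, dotProduct] using h0 j l hjl a b
  have hG : Gᵀ * G = 1 := (mul_eq_one_comm_of_card_eq _ _ _ (by simp [← hk, mul_comm])).mp hGG
  have hB : ∀ i, G * P i * Gᵀ = blockDiagonal fun j => B j i := fun i => by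
    ext ⟨a, j⟩ ⟨b, l⟩
    rw [blockDiagonal_apply, Matrix.mul_assoc]
    change (v j a).ofLp ⬝ᵥ P i *ᵥ (v l b).ofLp = _
    split_ifs with hjl
    · subst hjl
      rfl
    · rw [dotProduct_comm]
      simpa [PiLp.inner_apply, dotProduct, toLpLin_apply] using he0 i j l hjl a b
  have hmul : ∀ i i', blockDiagonal (fun j => B j i * B j i') = G * (P i * P i') * Gᵀ :=
    fun i i' => by
      rw [blockDiagonal_mul, ← hB, ← hB]
      calc _ = G * P i * (Gᵀ * G) * (P i' * Gᵀ) := by simp only [Matrix.mul_assoc]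
        _ = _ := by rw [hG]; simp only [Matrix.mul_assoc, Matrix.mul_one]
  refine ⟨k, hk.symm, G, B, hG, fun j => isCliffordSystem_iff.mpr ⟨fun i => ?_, fun i => ?_,
    fun i i' hi => ?_⟩, fun x => funext fun i => ?_⟩
  · ext a b
    change (v j b).ofLp ⬝ᵥ P i *ᵥ (v j a).ofLp = (v j a).ofLp ⬝ᵥ P i *ᵥ (v j b).ofLp
    rw [dotProduct_mulVec_comm_of_isSymm (hS i), dotProduct_comm]
  · refine congrFun (blockDiagonal_injective (?_ : blockDiagonal (fun j => B j i * B j i) =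
      blockDiagonal 1)) j
    rw [hmul, hsq, Matrix.mul_one, hGG, blockDiagonal_one]
  · refine congrFun (blockDiagonal_injective (?_ : blockDiagonal (fun j => B j i * B j i') =
      blockDiagonal (-fun j => B j i' * B j i))) j
    rw [blockDiagonal_neg, hmul, hmul, hac i i' hi, Matrix.mul_neg, Matrix.neg_mul]
  · have h1 : P i = Gᵀ * blockDiagonal (fun j => B j i) * G := by
      rw [← hB]
      calc _ = (Gᵀ * G) * P i * (Gᵀ * G) := by rw [hG, Matrix.one_mul, Matrix.mul_one]
        _ = _ := by simp only [Matrix.mul_assoc]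
    have h2 : cliffordMap P x i = G *ᵥ x ⬝ᵥ blockDiagonal (fun j => B j i) *ᵥ G *ᵥ x := by
      rw [cliffordMap, h1, ← mulVec_mulVec, ← mulVec_mulVec, dotProduct_mulVec, vecMul_transpose]
    rw [h2, Finset.sum_apply]
    simp only [cliffordMap, dotProduct, mulVec, Fintype.sum_prod_type, blockDiagonal_apply]
    rw [Finset.sum_comm]
    simp

end Decomposition

section Existence

theorem isCliffordSystem_submatrix {N n : ℕ} {ι : Type*} [Fintype ι] [DecidableEq ι]
    (σ : Fin N ≃ ι) {Q : Fin n → Matrix ι ι ℝ} (hS : ∀ i, (Q i).IsSymm)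
    (hsq : ∀ i, Q i * Q i = 1) (hac : ∀ i j, i ≠ j → Q i * Q j = -(Q j * Q i)) :
    IsCliffordSystem fun i => (Q i).submatrix σ σ := by
  refine isCliffordSystem_iff.mpr ⟨fun i => (hS i).submatrix σ, fun i => ?_, fun i j hij => ?_⟩
  · rw [submatrix_mul_equiv, hsq, submatrix_one_equiv]
  · rw [submatrix_mul_equiv, submatrix_mul_equiv, hac i j hij]
    rfl

theorem exists_isCliffordSystem : ∀ r, ∃ N, 0 < N ∧
    ∃ P : Fin r → Matrix (Fin N) (Fin N) ℝ, IsCliffordSystem P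
  | 0 => ⟨1, one_pos, fun i => i.elim0, fun i => i.elim0, fun i => i.elim0⟩
  | r + 1 => by
    obtain ⟨N, hN, P, hP⟩ := exists_isCliffordSystem r
    obtain ⟨hS, hsq, hac⟩ := isCliffordSystem_iff.mp hP
    refine ⟨N + N, by omega, _, isCliffordSystem_submatrix finSumFinEquiv.symm
      (Q := Fin.cons (fromBlocks 0 1 1 0) fun i => fromBlocks (P i) 0 0 (-P i)) ?_ ?_ ?_⟩
    · refine Fin.cases ?_ fun i => ?_
      · simp [Matrix.IsSymm, fromBlocks_transpose]
      · simp [Matrix.IsSymm, fromBlocks_transpose, (hS i).eq]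
    · refine Fin.cases ?_ fun i => ?_
      · simp [fromBlocks_multiply]
      · simp [fromBlocks_multiply, hsq]
    · refine Fin.cases (Fin.cases (fun h => absurd rfl h) fun j _ => ?_) fun i =>
        Fin.cases (fun _ => ?_) fun j hij => ?_
      · simp [fromBlocks_multiply, fromBlocks_neg]
      · simp [fromBlocks_multiply, fromBlocks_neg]
      · have h := hac i j fun h => hij (congrArg _ h)
        simp [fromBlocks_multiply, fromBlocks_neg, h]

theorem exists_isCliffordSystem_of_dim {n k : ℕ} (hn : 1 ≤ n) :
    ∃ P : Fin (n + 1) → Matrix (Fin (2 * k * mfun n)) (Fin (2 * k * mfun n)) ℝ,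
      IsCliffordSystem P := by
  obtain ⟨N, hN, P, hP⟩ := exists_isCliffordSystem (n + 1)
  obtain ⟨l, hl, -, B, -, hB, -⟩ := hP.exists_blocks hn
  have hl0 : 0 < l := Nat.pos_of_ne_zero fun h => by simp [h] at hl; omega
  obtain ⟨hS, hsq, hac⟩ := isCliffordSystem_iff.mp (hB ⟨0, hl0⟩)
  refine ⟨_, isCliffordSystem_submatrix
    ((finCongr (by ring)).trans (finProdFinEquiv (m := 2 * mfun n) (n := k)).symm)
    (Q := fun i => blockDiagonal fun _ => B ⟨0, hl0⟩ i) (fun i => ?_) (fun i => ?_)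
    fun i j hij => ?_⟩
  · rw [Matrix.IsSymm, blockDiagonal_transpose, (hS i).eq]
  · rw [← blockDiagonal_mul, hsq]
    exact blockDiagonal_one
  · rw [← blockDiagonal_mul, ← blockDiagonal_mul, hac i j hij]
    exact blockDiagonal_neg _

end Existence

theorem isOrthoMat_submatrix {M : ℕ} {ι : Type*} [Fintype ι] [DecidableEq ι]
    (σ : Fin M ≃ ι) {G : Matrix ι (Fin M) ℝ} (hG : Gᵀ * G = 1) :
    IsOrthoMat (G.submatrix σ id) := by
  rw [IsOrthoMat, transpose_submatrix, submatrix_mul_equiv, hG, submatrix_id_id]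

theorem umbilical_qhm_classification (n : ℕ) (hn : 1 ≤ n) :
    (∀ M : ℕ,
        (∃ φ : (Fin M → ℝ) → Fin (n + 1) → ℝ,
            IsQuadraticHM φ ∧ QNonsingular φ ∧ Umbilical φ) ↔
          ∃ k : ℕ, 0 < k ∧ M = 2 * k * mfun n) ∧
    (∀ φ : (Fin (2 * mfun n) → ℝ) → Fin (n + 1) → ℝ,
        IsQuadraticHM φ → QNonsingular φ → Umbilical φ →
        ∃ lam : ℝ, 0 < lam ∧
          ∃ φ₀ : (Fin (2 * mfun n) → ℝ) → Fin (n + 1) → ℝ,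
            MemH21 φ₀ ∧ DomainMinimal φ₀ ∧
              DomainEquiv φ fun x => lam • φ₀ x) ∧
    (∀ k : ℕ, 2 ≤ k →
        ∀ φ : (Fin (2 * k * mfun n) → ℝ) → Fin (n + 1) → ℝ,
          IsQuadraticHM φ → QNonsingular φ → Umbilical φ →
          ∃ lam : ℝ, 0 < lam ∧
            ∃ ψ : Fin k → (Fin (2 * mfun n) → ℝ) → Fin (n + 1) → ℝ,
              (∀ j, MemH21 (ψ j) ∧ DomainMinimal (ψ j)) ∧
                DomainEquiv φ
                  (reMap (show 2 * k * mfun n = k * (2 * mfun n) by ring)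
                    fun x => lam • bigDSum ψ x)) := by
  refine ⟨fun M => ⟨?_, ?_⟩, ?_, ?_⟩
  · rintro ⟨φ, hφ, hq, hu⟩
    obtain ⟨hM, c, hc, P, hP, -⟩ := hφ.exists_cliffordSystem (by omega) hq hu
    obtain ⟨k, hk, -⟩ := hP.exists_blocks hn
    refine ⟨k, Nat.pos_of_ne_zero fun h => ?_, by rw [hk]; ring⟩
    rw [h, zero_mul] at hk
    omega
  · rintro ⟨k, hk, rfl⟩
    obtain ⟨P, hP⟩ := exists_isCliffordSystem_of_dim (k := k) hn
    have h := hP.memH21 (Nat.mul_pos (Nat.mul_pos two_pos hk) (mfun_pos n)) (by omega)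
    exact ⟨_, h.1.1, h.2⟩
  · intro φ hφ hq hu
    obtain ⟨hM, c, hc, P, hP, hφP⟩ := hφ.exists_cliffordSystem (by omega) hq hu
    obtain ⟨k, hk, G, B, hG, hB, hPB⟩ := hP.exists_blocks hn
    obtain rfl : k = 1 := Nat.eq_of_mul_eq_mul_right hM (hk.symm.trans (one_mul _).symm)
    obtain ⟨h1, h2⟩ := (hB 0).domainMinimal hn
    refine ⟨c, hc, _, h1, h2, _, isOrthoMat_submatrix (Equiv.prodUnique _ _).symm hG, fun x => ?_⟩
    rw [hφP, hPB, Fin.sum_univ_one]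
    rfl
  · intro k hk φ hφ hq hu
    obtain ⟨hM, c, hc, P, hP, hφP⟩ := hφ.exists_cliffordSystem (by omega) hq hu
    obtain ⟨l, hl, G, B, hG, hB, hPB⟩ := hP.exists_blocks hn
    have hkl : 2 * k * mfun n = k * (2 * mfun n) := by ring
    obtain rfl : k = l := Nat.eq_of_mul_eq_mul_right (Nat.mul_pos two_pos (mfun_pos n))
      (hkl.symm.trans hl)
    refine ⟨c, hc, fun j => cliffordMap (B j), fun j => (hB j).domainMinimal hn, _,
      isOrthoMat_submatrix ((finCongr hkl).trans
        (finProdFinEquiv.symm.trans (Equiv.prodComm _ _))) hG, fun x => ?_⟩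
    rw [hφP, hPB]
    refine congrArg (c • ·) (Finset.sum_congr rfl fun j _ => congrArg _ (funext fun a => ?_))
    simp [mulVec]
end
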